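/- Every countable left-orderable group G admits a Frattini embedding into a finitely generated simple group H that is left-orderable. -/

import Mathlib

-- The sign (−1, 0, or 1) of a group element relative to the identity,
-- with respect to a linear order `l`.
open Classical in
noncomputable def orderSign {H : Type*} [Group H] (l : LinearOrder H) (h : H) : ℤ :=
  if l.lt h 1 then -1 else if h = 1 then 0 else 1

/-- A group is left-orderable if it carries a left-invariant linear order. -/
def IsLeftOrderable (G : Type*) [Group G] : Prop :=
  ∃ l : LinearOrder G, ∀ a b c : G, l.le b c → l.le (a * b) (a * c)

/-- A Frattini embedding: an injective homomorphism preserving and reflecting conjugacy. -/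
def IsFrattini {G H : Type*} [Group G] [Group H] (φ : G →* H) : Prop :=
  Function.Injective φ ∧ ∀ a b : G, IsConj a b ↔ IsConj (φ a) (φ b)

/-- `X` is a (finite) generating set of the group. -/
def Generates {G : Type*} [Group G] (X : Finset G) : Prop :=
  Subgroup.closure (X : Set G) = ⊤

/-- Word length of `g` with respect to the finite set `X`: the least length of a word
over `X ∪ X⁻¹` representing `g`. -/
noncomputable def wordLength {G : Type*} [Group G] (X : Finset G) (g : G) : ℕ :=
  sInf {n | ∃ w : List G, w.length = n ∧ (∀ a ∈ w, a ∈ X ∨ a⁻¹ ∈ X) ∧ w.prod = g}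

/-- Quasi-isometric embedding with respect to finite generating sets `X` and `Y`. -/
noncomputable def IsQIEmbedding {G H : Type*} [Group G] [Group H]
    (X : Finset G) (Y : Finset H) (φ : G →* H) : Prop :=
  Function.Injective φ ∧ ∃ C k : ℝ, 0 < C ∧ 0 < k ∧ ∀ g : G,
    (1 / C) * (wordLength X g : ℝ) - k ≤ (wordLength Y (φ g) : ℝ) ∧
    (wordLength Y (φ g) : ℝ) ≤ C * (wordLength X g : ℝ) + k

/-- Evaluation of a formal word (list of pairs (index, sign)) over the
enumerated sequence `x : ℕ → G`. -/
def evalWord {G : Type*} [Group G] (x : ℕ → G) (w : List (ℕ × Bool)) : G :=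
  (w.map (fun p => if p.2 then x p.1 else (x p.1)⁻¹)).prod

/-- A computable left order on a countable group with respect to an enumerated
generating sequence `x : ℕ → G`. -/
def ComputableLeftOrderWrt {G : Type*} [Group G] (x : ℕ → G) : Prop :=
  ∃ l : LinearOrder G, (∀ a b c : G, l.le b c → l.le (a * b) (a * c)) ∧
    Computable (fun w : List (ℕ × Bool) => orderSign l (evalWord x w))

/-- A computable left order on a finitely generated group, presented by
a surjection `π` from a free group of finite rank. -/
def ComputableLeftOrderVia {H : Type*} [Group H] {m : ℕ}
    (π : FreeGroup (Fin m) →* H) : Prop :=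
  ∃ l : LinearOrder H, (∀ a b c : H, l.le b c → l.le (a * b) (a * c)) ∧
    Computable (fun w : List (Fin m × Bool) => orderSign l (π (FreeGroup.mk w)))

/-- The embedding `φ` is computable: one can compute, for each `i`, a word over the
generators of `H` representing `φ (x i)`. -/
def ComputableEmbedding {G H : Type*} [Group G] [Group H] (x : ℕ → G) {m : ℕ}
    (π : FreeGroup (Fin m) →* H) (φ : G →* H) : Prop :=
  ∃ f : ℕ → List (Fin m × Bool), Computable f ∧ ∀ i, π (FreeGroup.mk (f i)) = φ (x i)

/-- Decidable membership problem for the image of `φ` in `H`, presented via `π`. -/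
def DecidableMembership {G H : Type*} [Group G] [Group H] {m : ℕ}
    (π : FreeGroup (Fin m) →* H) (φ : G →* H) : Prop :=
  ComputablePred (fun w : List (Fin m × Bool) => π (FreeGroup.mk w) ∈ φ.range)

/-- Decidable word problem for `H`, presented via `π`. -/
def DecidableWordProblemVia {H : Type*} [Group H] {m : ℕ}
    (π : FreeGroup (Fin m) →* H) : Prop :=
  ComputablePred (fun w : List (Fin m × Bool) => π (FreeGroup.mk w) = 1)

/-- A group is finitely presented: quotient of a finite-rank free group by the
normal closure of finitely many relators. -/
def IsFinitelyPresented (K : Type*) [Group K] : Prop :=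
  ∃ (m : ℕ) (π : FreeGroup (Fin m) →* K) (R : Finset (FreeGroup (Fin m))),
    Function.Surjective π ∧ π.ker = Subgroup.normalClosure (R : Set (FreeGroup (Fin m)))

namespace FE
open Equiv

/-- Start of the tile containing `v`. -/
def start (c p M v : ℤ) : ℤ := v - p - (v - p - c) % M

lemma start_dvd (c p M v : ℤ) : M ∣ start c p M v - c := by
  have h : start c p M v - c = (v - p - c) - (v - p - c) % M := by unfold start; ring
  rw [h]; exact Int.dvd_self_sub_emod

lemma start_le (c p : ℤ) {M : ℤ} (hM : 0 < M) (v : ℤ) : start c p M v + p ≤ v := by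
  have := Int.emod_nonneg (v - p - c) hM.ne'
  unfold start; linarith

lemma lt_start (c p : ℤ) {M : ℤ} (hM : 0 < M) (v : ℤ) : v < start c p M v + p + M := by
  have := Int.emod_lt_of_pos (v - p - c) hM
  unfold start; linarith

lemma start_eq {c p M v n : ℤ} (h1 : M ∣ n - c) (h2 : n + p ≤ v) (h3 : v < n + p + M) :
    start c p M v = n := by
  unfold start
  obtain ⟨k, hk⟩ := h1
  have : (v - p - c) % M = v - p - n := by
    have e : v - p - c = (v - p - n) + M * k := by rw [← hk]; ring
    rw [e, Int.add_mul_emod_self_left]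
    exact Int.emod_eq_of_lt (by linarith) (by linarith)
  rw [this]; ring

/-- Data: line `Ω` with floor, translation, bump and a finite set of conjugators. -/
structure Dat (Ω : Type) [LinearOrder Ω] where
  fl : Ω → ℤ
  t : Perm Ω
  β : Perm Ω
  fl_mono : Monotone fl
  fl_t : ∀ x, fl (t x) = fl x + 1
  t_mono : StrictMono t
  β_mono : StrictMono β
  β_supp : ∀ x, ¬ (0 ≤ fl x ∧ fl x < 2) → β x = x
  ident : (t ^ (2:ℤ) * β * t ^ (-2:ℤ)) * (t ^ (1:ℤ) * β * t ^ (-1:ℤ)) * β =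
    (t ^ (1:ℤ) * β * t ^ (-1:ℤ)) * β * (t ^ (2:ℤ) * β * t ^ (-2:ℤ)) * (t ^ (1:ℤ) * β * t ^ (-1:ℤ))
  Φ : Set (Perm Ω)
  fin : Φ.Finite
  one_mem : 1 ∈ Φ
  Φ_mono : ∀ φ ∈ Φ, StrictMono φ
  Φ_fl : ∀ φ ∈ Φ, ∀ x, fl (φ x) = fl x
  Φ_comm : ∀ φ ∈ Φ, Commute φ (t ^ (4:ℤ))

variable {Ω : Type} [LinearOrder Ω] (D : Dat Ω)

namespace Dat

lemma fl_zpow (n : ℤ) (x : Ω) : D.fl ((D.t ^ n) x) = D.fl x + n := by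
  induction n using Int.induction_on generalizing x with
  | zero => simp
  | succ n ih => rw [zpow_add_one, Perm.mul_apply, ih, D.fl_t]; ring
  | pred n ih =>
    rw [zpow_sub_one, Perm.mul_apply, ih]
    have := D.fl_t (D.t⁻¹ x)
    rw [show D.t (D.t⁻¹ x) = x by simp] at this
    rw [this]; ring

/-- Permutations supported in the window `[p, p+M)`. -/
def W (p M : ℤ) : Subgroup (Perm Ω) where
  carrier := {s | ∀ x, ¬ (p ≤ D.fl x ∧ D.fl x < p + M) → s x = x}
  one_mem' := by intro x _; rfl
  mul_mem' := by
    intro a b ha hb x hx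
    rw [Perm.mul_apply, hb x hx, ha x hx]
  inv_mem' := by
    intro a ha x hx
    rw [Perm.inv_eq_iff_eq, ha x hx]

lemma W_fl {p M : ℤ} {s : Perm Ω} (hs : s ∈ D.W p M) {x : Ω}
    (hx : p ≤ D.fl x ∧ D.fl x < p + M) : p ≤ D.fl (s x) ∧ D.fl (s x) < p + M := by
  by_contra h
  have := hs _ h
  have h2 := s.injective this
  rw [h2] at h; exact h hx

/-- Bump at position `j`. -/
def bj (j : ℤ) : Perm Ω := D.t ^ j * D.β * D.t ^ (-j)

lemma conj_apply (s : Perm Ω) (n : ℤ) (x : Ω) :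
    (D.t ^ n * s * D.t ^ (-n)) x = (D.t ^ n) (s ((D.t ^ (-n)) x)) := rfl

lemma conj_conj (n j : ℤ) (s : Perm Ω) :
    D.t ^ n * (D.t ^ j * s * D.t ^ (-j)) * D.t ^ (-n) = D.t ^ (n + j) * s * D.t ^ (-(n+j)) := by
  rw [zpow_add, neg_add_rev, zpow_add]; group

lemma conj_W {p M : ℤ} {s : Perm Ω} (hs : s ∈ D.W p M) (n : ℤ) :
    D.t ^ n * s * D.t ^ (-n) ∈ D.W (n + p) M := by
  intro x hx
  rw [conj_apply, hs, ← Perm.mul_apply, ← zpow_add]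
  · simp
  · rw [fl_zpow]; intro h; apply hx; constructor <;> linarith [h.1, h.2]

lemma W_le {p M p' M' : ℤ} (h1 : p' ≤ p) (h2 : p + M ≤ p' + M') : D.W p M ≤ D.W p' M' := by
  intro s hs x hx
  apply hs
  intro h; apply hx; constructor <;> linarith [h.1, h.2]

lemma β_W : D.β ∈ D.W 0 2 := by
  intro x hx; apply D.β_supp; simpa using hx

lemma bj_W (j : ℤ) : D.bj j ∈ D.W j 2 := by
  have := D.conj_W D.β_W j
  simpa [bj] using this

/-- Spreading a family of window-supported permutations over tiles. -/
def spf (c p M : ℤ) (σ : ℤ → D.W p M) (x : Ω) : Ω :=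
  (D.t ^ (start c p M (D.fl x)) * (σ (start c p M (D.fl x)) : Perm Ω) *
    D.t ^ (-(start c p M (D.fl x)))) x

variable {c p M : ℤ}

lemma spf_window (hM : 0 < M) (σ : ℤ → D.W p M) (x : Ω) :
    start c p M (D.fl x) + p ≤ D.fl (D.spf c p M σ x) ∧
      D.fl (D.spf c p M σ x) < start c p M (D.fl x) + p + M := by
  have := D.W_fl (D.conj_W (σ (start c p M (D.fl x))).2 (start c p M (D.fl x))) (x := x)
    ⟨start_le c p hM _, lt_start c p hM _⟩
  exact this

lemma start_spf (hM : 0 < M) (σ : ℤ → D.W p M) (x : Ω) :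
    start c p M (D.fl (D.spf c p M σ x)) = start c p M (D.fl x) :=
  start_eq (start_dvd _ _ _ _) (D.spf_window hM σ x).1 (D.spf_window hM σ x).2

/-- Spreading as a homomorphism. -/
def Sp (c p : ℤ) {M : ℤ} (hM : 0 < M) : (ℤ → D.W p M) →* Perm Ω :=
  MonoidHom.toHomPerm
    { toFun := fun σ => (D.spf c p M σ : Function.End Ω)
      map_one' := by
        funext x
        change D.spf c p M 1 x = x
        simp [spf]
      map_mul' := by
        intro σ σ'
        funext x
        change D.spf c p M (σ * σ') x = D.spf c p M σ (D.spf c p M σ' x)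
        rw [spf, spf, start_spf D hM, spf]
        simp only [Pi.mul_apply, Subgroup.coe_mul]
        rw [← Perm.mul_apply]
        congr 1
        group }

lemma Sp_apply (hM : 0 < M) (σ : ℤ → D.W p M) (x : Ω) :
    D.Sp c p hM σ x = (D.t ^ (start c p M (D.fl x)) * (σ (start c p M (D.fl x)) : Perm Ω) *
    D.t ^ (-(start c p M (D.fl x)))) x := rfl

lemma Sp_apply_of (hM : 0 < M) (σ : ℤ → D.W p M) {x : Ω} {n : ℤ} (h1 : M ∣ n - c)
    (h2 : n + p ≤ D.fl x) (h3 : D.fl x < n + p + M) :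
    D.Sp c p hM σ x = (D.t ^ n * (σ n : Perm Ω) * D.t ^ (-n)) x := by
  rw [Sp_apply, start_eq h1 h2 h3]

lemma Sp_congr (hM : 0 < M) {σ σ' : ℤ → D.W p M} (h : ∀ n, M ∣ n - c → σ n = σ' n) :
    D.Sp c p hM σ = D.Sp c p hM σ' := by
  ext x
  rw [Sp_apply, Sp_apply, h _ (start_dvd _ _ _ _)]

lemma zpow_mono (n : ℤ) : StrictMono (D.t ^ n : Perm Ω) := by
  have hinv : StrictMono (D.t⁻¹ : Perm Ω) := by
    intro a b hab
    rw [← D.t_mono.lt_iff_lt]; simpa using hab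
  induction n using Int.induction_on with
  | zero => intro a b h; simpa using h
  | succ n ih => rw [zpow_add_one]; exact ih.comp D.t_mono
  | pred n ih => rw [zpow_sub_one]; exact ih.comp hinv

lemma lt_of_fl_lt {x y : Ω} (h : D.fl x < D.fl y) : x < y := by
  by_contra hc
  exact absurd (D.fl_mono (not_lt.mp hc)) (not_le.mpr h)

lemma Sp_mono (hM : 0 < M) {σ : ℤ → D.W p M} (h : ∀ n, StrictMono ((σ n : Perm Ω))) :
    StrictMono (D.Sp c p hM σ) := by
  intro x y hxy
  have w1 := D.spf_window (c := c) hM σ x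
  have w2 := D.spf_window (c := c) hM σ y
  by_cases he : start c p M (D.fl x) = start c p M (D.fl y)
  · rw [Sp_apply, Sp_apply, he]
    exact ((D.zpow_mono _).comp ((h _).comp (D.zpow_mono _))) hxy
  · apply D.lt_of_fl_lt
    change D.fl (D.spf c p M σ x) < D.fl (D.spf c p M σ y)
    have hle := D.fl_mono hxy.le
    have a1 := start_le c p hM (D.fl x)
    have a2 := lt_start c p hM (D.fl x)
    have b1 := start_le c p hM (D.fl y)
    have b2 := lt_start c p hM (D.fl y)
    obtain ⟨k, hk⟩ := start_dvd c p M (D.fl x)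
    obtain ⟨l, hl⟩ := start_dvd c p M (D.fl y)
    have hkl : k < l := by
      by_contra hc
      push Not at hc
      rcases hc.lt_or_eq with hc | hc
      · have : M * (l + 1) ≤ M * k := by gcongr; omega
        nlinarith
      · subst hc; apply he; linarith
    have : M * (k + 1) ≤ M * l := by gcongr; omega
    nlinarith [w1.2, w2.1]

end Dat
end FE

namespace FE
open Equiv
namespace Dat
variable {Ω : Type} [LinearOrder Ω] (D : Dat Ω)

open Classical in
/-- The family equal to `s` on indices in `A` and trivial elsewhere. -/
noncomputable def fam {p M : ℤ} (s : D.W p M) (j : ℤ) (A : Set ℤ) : ℤ → D.W p M :=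
  fun n => if n + j ∈ A then s else 1

lemma β_W4 : D.β ∈ D.W 0 4 := D.W_le (by norm_num) (by norm_num) D.β_W

/-- Spread bumps. -/
noncomputable def bb (c : ℤ) (A : Set ℤ) : Perm Ω :=
  D.Sp c 0 (M := 4) (by norm_num) (D.fam ⟨D.β, D.β_W4⟩ 0 A)

open Classical in
lemma bb_apply {c : ℤ} {A : Set ℤ} {x : Ω} {n : ℤ} (h1 : (4:ℤ) ∣ n - c) (h2 : n ≤ D.fl x)
    (h3 : D.fl x < n + 4) : D.bb c A x = if n ∈ A then D.bj n x else x := by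
  rw [bb, Sp_apply_of D _ _ h1 (by linarith) (by linarith)]
  unfold fam
  rw [add_zero]
  split_ifs
  · rfl
  · simp

lemma bj_supp {j : ℤ} {x : Ω} (h : ¬ (j ≤ D.fl x ∧ D.fl x < j + 2)) : D.bj j x = x :=
  D.bj_W j x h

lemma tile {c p M j : ℤ} (hM : 0 < M) (h4 : (4:ℤ) ∣ M) (h1 : p ≤ j) (h2 : j + 2 ≤ p + M)
    (hs : D.bj j ∈ D.W p M) (A : Set ℤ) :
    D.Sp c p hM (D.fam ⟨D.bj j, hs⟩ j A) = D.bb (c + j) {n | n ∈ A ∧ M ∣ n - c - j} := by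
  classical
  ext x
  set v := D.fl x with hv
  set n := start c p M v with hn
  set m := start (c+j) 0 4 v with hm
  have a1 := start_le c p hM v
  have a2 := lt_start c p hM v
  have a3 := start_dvd c p M v
  have b1 := start_le (c+j) 0 (M := 4) (by norm_num) v
  have b2 := lt_start (c+j) 0 (M := 4) (by norm_num) v
  have b3 := start_dvd (c+j) 0 4 v
  rw [← hn] at a1 a2 a3
  rw [← hm] at b1 b2 b3
  rw [Sp_apply_of D hM _ a3 (by linarith) (by linarith), bb_apply D b3 (by linarith) (by linarith)]
  have e : (D.t ^ n * ((D.fam ⟨D.bj j, hs⟩ j A n : D.W p M) : Perm Ω) * D.t ^ (-n)) x =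
      if n + j ∈ A then D.bj (n + j) x else x := by
    unfold fam
    split_ifs
    · change (D.t ^ n * D.bj j * D.t ^ (-n)) x = _
      rw [bj, conj_conj]; rfl
    · simp
  rw [e]
  by_cases hmn : m = n + j
  · have : M ∣ m - c - j := by rw [hmn]; convert a3 using 1; ring
    simp only [Set.mem_ofPred_eq, this, and_true]
    rw [hmn]
  · have l : (if n + j ∈ A then D.bj (n + j) x else x) = x := by
      split_ifs
      · apply bj_supp
        rintro ⟨q1, q2⟩
        apply hmn
        apply start_eq
        · have : n + j - (c + j) = n - c := by ring
          rw [this]; exact h4.trans a3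
        · linarith
        · linarith
      · rfl
    rw [l]
    split_ifs with hif
    · symm
      apply bj_supp
      rintro ⟨q1, q2⟩
      apply hmn
      have : n = m - j := by
        apply start_eq
        · have := hif.2
          convert this using 1; ring
        · linarith
        · linarith
      linarith
    · rfl

lemma bb_congr {c c' : ℤ} {A A' : Set ℤ} (hc : (4:ℤ) ∣ c - c')
    (h : ∀ n, (4:ℤ) ∣ n - c → (n ∈ A ↔ n ∈ A')) : D.bb c A = D.bb c' A' := by
  classical
  ext x
  have b1 := start_le c 0 (M := 4) (by norm_num) (D.fl x)
  have b2 := lt_start c 0 (M := 4) (by norm_num) (D.fl x)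
  have b3 := start_dvd c 0 4 (D.fl x)
  rw [bb_apply D b3 (by linarith) (by linarith),
    bb_apply D (c := c') (n := start c 0 4 (D.fl x)) _ (by linarith) (by linarith)]
  · simp only [h _ b3]
  · rw [show start c 0 4 (D.fl x) - c' = (start c 0 4 (D.fl x) - c) + (c - c') by ring]
    exact dvd_add b3 hc

lemma bj_W4 {j : ℤ} (h0 : 0 ≤ j) (h2 : j ≤ 2) : D.bj j ∈ D.W 0 4 :=
  D.W_le (by linarith) (by linarith) (D.bj_W j)

lemma bb_eq (c : ℤ) {j : ℤ} (h0 : 0 ≤ j) (h2 : j ≤ 2) (A : Set ℤ) :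
    D.bb (c + j) A =
      D.Sp c 0 (M := 4) (by norm_num) (D.fam ⟨D.bj j, D.bj_W4 h0 h2⟩ j A) := by
  rw [tile D (by norm_num) (by norm_num) h0 (by linarith)]
  apply bb_congr D (by simp)
  intro n hn
  have : (4:ℤ) ∣ n - c - j := by convert hn using 1; ring
  simp [this]

lemma bj_comm : D.bj 0 * D.bj 2 = D.bj 2 * D.bj 0 := by
  ext x
  simp only [Perm.mul_apply]
  by_cases h : 0 ≤ D.fl x ∧ D.fl x < 0 + 2
  · have := D.W_fl (D.bj_W 0) h
    rw [D.bj_supp (x := D.bj 0 x) (j := 2) (by omega), D.bj_supp (x := x) (j := 2) (by omega)]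
  · rw [D.bj_supp h]
    by_cases h' : 2 ≤ D.fl x ∧ D.fl x < 2 + 2
    · have := D.W_fl (D.bj_W 2) h'
      rw [D.bj_supp (j := 0) (by omega)]
    · rw [D.bj_supp h', D.bj_supp h]

lemma ident' : D.bj 2 * D.bj 1 * D.bj 0 = D.bj 1 * D.bj 0 * D.bj 2 * D.bj 1 := by
  have h0 : D.bj 0 = D.β := by simp [bj]
  rw [h0]; exact D.ident

lemma grp1 {G : Type*} [Group G] {a b c : G} (h1 : a * c = c * a)
    (h : c * b * a = b * a * c * b) :
    (c * b * c⁻¹) * a * (c * b * c⁻¹)⁻¹ * a⁻¹ = b := by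
  have e : c⁻¹ * a * c = a := by rw [mul_assoc, h1]; group
  calc (c * b * c⁻¹) * a * (c * b * c⁻¹)⁻¹ * a⁻¹
      = c * b * (c⁻¹ * a * c) * b⁻¹ * c⁻¹ * a⁻¹ := by group
    _ = (c * b * a) * b⁻¹ * c⁻¹ * a⁻¹ := by rw [e]
    _ = b := by rw [h]; group

lemma grp2 {G : Type*} [Group G] {a b c : G} (h1 : a * c = c * a)
    (h : c * b * a = b * a * c * b) :
    c⁻¹ * (a⁻¹ * b⁻¹ * a) * c * (a⁻¹ * b⁻¹ * a)⁻¹ = b := by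
  have e : a * c * a⁻¹ = c := by rw [h1]; group
  calc c⁻¹ * (a⁻¹ * b⁻¹ * a) * c * (a⁻¹ * b⁻¹ * a)⁻¹
      = c⁻¹ * a⁻¹ * b⁻¹ * (a * c * a⁻¹) * b * a := by group
    _ = c⁻¹ * a⁻¹ * b⁻¹ * (c * b * a) := by rw [e]; group
    _ = (a * c)⁻¹ * (c * a) * b := by rw [h, h1]; simp only [mul_assoc]; group
    _ = b := by rw [h1]; group

lemma form1 (c : ℤ) (A A' : Set ℤ) :
    D.bb (c+1) (A ∩ A') = (D.bb (c+2) Set.univ * D.bb (c+1) A * (D.bb (c+2) Set.univ)⁻¹) *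
      D.bb c {n | n + 1 ∈ A'} * (D.bb (c+2) Set.univ * D.bb (c+1) A * (D.bb (c+2) Set.univ)⁻¹)⁻¹ *
      (D.bb c {n | n + 1 ∈ A'})⁻¹ := by
  have e0 := D.bb_eq c (j := 0) (by norm_num) (by norm_num) {n | n + 1 ∈ A'}
  rw [add_zero] at e0
  rw [e0, bb_eq D c (by norm_num) (by norm_num), bb_eq D c (by norm_num) (by norm_num),
    bb_eq D c (by norm_num) (by norm_num)]
  simp only [← map_mul, ← map_inv]
  congr 1
  funext n
  apply Subtype.ext
  have := grp1 D.bj_comm D.ident'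
  by_cases h1 : n + 1 ∈ A <;> by_cases h2 : n + 1 ∈ A' <;>
    simp [fam, h1, h2, -mul_inv_rev]
  exact this.symm

lemma form2 (c : ℤ) (A A' : Set ℤ) :
    D.bb (c+1) (A ∩ A') = (D.bb (c+2) {n | n - 1 ∈ A'})⁻¹ *
      ((D.bb c Set.univ)⁻¹ * (D.bb (c+1) A)⁻¹ * D.bb c Set.univ) *
      (D.bb (c+2) {n | n - 1 ∈ A'}) *
      ((D.bb c Set.univ)⁻¹ * (D.bb (c+1) A)⁻¹ * D.bb c Set.univ)⁻¹ := by
  have e0 := D.bb_eq c (j := 0) (by norm_num) (by norm_num) Set.univ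
  rw [add_zero] at e0
  rw [e0, bb_eq D c (by norm_num) (by norm_num), bb_eq D c (by norm_num) (by norm_num),
    bb_eq D c (by norm_num) (by norm_num)]
  simp only [← map_mul, ← map_inv]
  congr 1
  funext n
  apply Subtype.ext
  have := grp2 D.bj_comm D.ident'
  have e : n + 2 - 1 = n + 1 := by ring
  by_cases h1 : n + 1 ∈ A <;> by_cases h2 : n + 1 ∈ A' <;>
    simp [fam, h1, h2, e, -mul_inv_rev]
  exact this.symm

lemma bb_compl (c : ℤ) (A : Set ℤ) : D.bb c Aᶜ = D.bb c Set.univ * (D.bb c A)⁻¹ := by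
  unfold bb
  simp only [← map_mul, ← map_inv]
  congr 1
  funext n
  by_cases h : n ∈ A <;> simp [fam, h]

lemma bb_union (c : ℤ) {A B : Set ℤ} (h : Disjoint A B) :
    D.bb c (A ∪ B) = D.bb c A * D.bb c B := by
  unfold bb
  simp only [← map_mul]
  congr 1
  funext n
  have : n ∈ A → n ∉ B := fun q => Set.disjoint_left.mp h q
  by_cases h : n ∈ A <;> by_cases h' : n ∈ B <;> simp [fam, h, h']
  exact absurd h' (this h)

/-- The Toeplitz set. -/
def E : Set ℤ := {n | Even (padicValInt 2 n)}

/-- Generators. -/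
def gens : Set (Perm Ω) :=
  {g | ∃ φ ∈ D.Φ, ∃ c ∈ Finset.Icc (0:ℤ) 3, ∃ A ∈ ({Set.univ, E} : Set (Set ℤ)),
    g = φ * D.bb c A * φ⁻¹}

lemma gens_fin : D.gens.Finite := by
  have h : (((D.Φ ×ˢ (Finset.Icc (0:ℤ) 3 : Set ℤ)) ×ˢ ({Set.univ, E} : Set (Set ℤ)))).Finite :=
    (D.fin.prod (Finset.finite_toSet _)).prod (Set.toFinite _)
  apply (h.image (fun q => q.1.1 * D.bb q.1.2 q.2 * q.1.1⁻¹)).subset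
  rintro g ⟨φ, hφ, c, hc, A, hA, rfl⟩
  exact ⟨((φ, c), A), ⟨⟨hφ, by exact_mod_cast hc⟩, hA⟩, rfl⟩

/-- The group. -/
def H : Subgroup (Perm Ω) := Subgroup.closure D.gens

/-- Index sets whose spread bumps lie in `N`. -/
def Sn (N : Subgroup (Perm Ω)) : Set (Set ℤ) :=
  {A | ∀ φ ∈ D.Φ, ∀ c, φ * D.bb c A * φ⁻¹ ∈ N}

lemma bb_mod (c : ℤ) (A : Set ℤ) : D.bb c A = D.bb (c % 4) A :=
  D.bb_congr (Int.dvd_self_sub_emod) (fun _ _ => Iff.rfl)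

lemma gen_mem {A : Set ℤ} (hA : A ∈ ({Set.univ, E} : Set (Set ℤ))) : A ∈ D.Sn D.H := by
  intro φ hφ c
  rw [bb_mod]
  apply Subgroup.subset_closure
  refine ⟨φ, hφ, c % 4, ?_, A, hA, rfl⟩
  rw [Finset.mem_Icc]; omega

lemma univ_mem : Set.univ ∈ D.Sn D.H := D.gen_mem (by simp)
lemma E_mem : E ∈ D.Sn D.H := D.gen_mem (by simp)

variable {N : Subgroup (Perm Ω)}

lemma Sn_mono (h : N ≤ D.H) {A : Set ℤ} (hA : A ∈ D.Sn N) : A ∈ D.Sn D.H :=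
  fun φ hφ c => h (hA φ hφ c)

lemma Sn_compl {A : Set ℤ} (hA : A ∈ D.Sn D.H) : Aᶜ ∈ D.Sn D.H := by
  intro φ hφ c
  rw [bb_compl]
  have := mul_mem (D.univ_mem φ hφ c) (inv_mem (hA φ hφ c))
  convert this using 1; group

lemma Sn_union {A B : Set ℤ} (hA : A ∈ D.Sn N) (hB : B ∈ D.Sn N) (h : Disjoint A B) :
    A ∪ B ∈ D.Sn N := by
  intro φ hφ c
  rw [bb_union D c h]
  have := mul_mem (hA φ hφ c) (hB φ hφ c)
  convert this using 1; group

lemma Sn_form1 {A A' : Set ℤ} (φ : Perm Ω) (hφ : φ ∈ D.Φ)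
    (hA : A ∈ D.Sn D.H) (hA' : {n | n + 1 ∈ A'} ∈ D.Sn N)
    (hN : ∀ h ∈ D.H, ∀ n ∈ N, h * n * h⁻¹ ∈ N) (c : ℤ) : φ * D.bb c (A ∩ A') * φ⁻¹ ∈ N := by
  obtain ⟨c, rfl⟩ : ∃ d, c = d + 1 := ⟨c - 1, by ring⟩
  rw [form1]
  have hX := D.univ_mem φ hφ (c+2)
  have hY := hA φ hφ (c+1)
  have hZ := hA' φ hφ c
  have := mul_mem (hN _ (mul_mem (mul_mem hX hY) (inv_mem hX)) _ hZ) (inv_mem hZ)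
  convert this using 1; group

lemma Sn_form1' {A A' : Set ℤ} (φ : Perm Ω) (hφ : φ ∈ D.Φ)
    (hA : A ∈ D.Sn N) (hA' : {n | n + 1 ∈ A'} ∈ D.Sn D.H)
    (hN : ∀ h ∈ D.H, ∀ n ∈ N, h * n * h⁻¹ ∈ N) (c : ℤ) : φ * D.bb c (A ∩ A') * φ⁻¹ ∈ N := by
  obtain ⟨c, rfl⟩ : ∃ d, c = d + 1 := ⟨c - 1, by ring⟩
  rw [form1]
  have hX := D.univ_mem φ hφ (c+2)
  have hY := hA φ hφ (c+1)
  have hZ := hA' φ hφ c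
  have hK := hN _ hX _ hY
  have := mul_mem hK (hN _ hZ _ (inv_mem hK))
  convert this using 1; group

lemma Sn_form2 {A A' : Set ℤ} (φ : Perm Ω) (hφ : φ ∈ D.Φ)
    (hA : A ∈ D.Sn D.H) (hA' : {n | n - 1 ∈ A'} ∈ D.Sn N)
    (hN : ∀ h ∈ D.H, ∀ n ∈ N, h * n * h⁻¹ ∈ N) (c : ℤ) : φ * D.bb c (A ∩ A') * φ⁻¹ ∈ N := by
  obtain ⟨c, rfl⟩ : ∃ d, c = d + 1 := ⟨c - 1, by ring⟩
  rw [form2]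
  have hX := D.univ_mem φ hφ c
  have hY := hA φ hφ (c+1)
  have hZ := hA' φ hφ (c+2)
  have := mul_mem (inv_mem hZ) (hN _ (mul_mem (mul_mem (inv_mem hX) (inv_mem hY)) hX) _ hZ)
  convert this using 1; group

lemma Sn_up {A : Set ℤ} (hN : ∀ h ∈ D.H, ∀ n ∈ N, h * n * h⁻¹ ∈ N) (hA : A ∈ D.Sn N) :
    {n | n - 1 ∈ A} ∈ D.Sn N := by
  intro φ hφ c
  have := D.Sn_form1 (A' := {n | n - 1 ∈ A}) φ hφ D.univ_mem (by simpa using hA) hN c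
  simpa using this

lemma Sn_down {A : Set ℤ} (hN : ∀ h ∈ D.H, ∀ n ∈ N, h * n * h⁻¹ ∈ N) (hA : A ∈ D.Sn N) :
    {n | n + 1 ∈ A} ∈ D.Sn N := by
  intro φ hφ c
  have := D.Sn_form2 (A' := {n | n + 1 ∈ A}) φ hφ D.univ_mem (by simpa using hA) hN c
  simpa using this

lemma Sn_shift {A : Set ℤ} (hN : ∀ h ∈ D.H, ∀ n ∈ N, h * n * h⁻¹ ∈ N) (hA : A ∈ D.Sn N)
    (k : ℤ) : {n | n + k ∈ A} ∈ D.Sn N := by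
  induction k using Int.induction_on with
  | zero => simpa using hA
  | succ k ih =>
    have := D.Sn_down hN ih
    convert this using 2
    ext n; simp only [Set.mem_ofPred_eq]; rw [show n + ((k:ℤ) + 1) = n + 1 + k by ring]
  | pred k ih =>
    have := D.Sn_up hN ih
    convert this using 2
    ext n; simp only [Set.mem_ofPred_eq]; rw [show n + (-(k:ℤ) - 1) = n - 1 + -k by ring]

lemma H_norm : ∀ h ∈ D.H, ∀ n ∈ D.H, h * n * h⁻¹ ∈ D.H :=
  fun _ hh _ hn => mul_mem (mul_mem hh hn) (inv_mem hh)

lemma Sn_inter {A A' : Set ℤ} (hN : ∀ h ∈ D.H, ∀ n ∈ N, h * n * h⁻¹ ∈ N)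
    (hA : A ∈ D.Sn N) (hA' : A' ∈ D.Sn D.H) : A ∩ A' ∈ D.Sn N :=
  fun φ hφ c => D.Sn_form1' φ hφ hA (D.Sn_shift D.H_norm hA' 1) hN c

end Dat
end FE

namespace FE
open Equiv
namespace Dat
variable {Ω : Type} [LinearOrder Ω] (D : Dat Ω)

lemma E_iff (k : ℕ) {m : ℤ} (hm : Odd m) : 2 ^ k * m ∈ E ↔ Even k := by
  have : padicValInt 2 (2 ^ k * m) = k := by
    have hm0 : m ≠ 0 := by rintro rfl; simp at hm
    rw [padicValInt.mul (by positivity) hm0]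
    have h1 : padicValInt 2 m = 0 := by
      apply padicValInt.eq_zero_of_not_dvd
      intro h
      have h2 : Even m := even_iff_two_dvd.mpr (by exact_mod_cast h)
      exact (Int.not_even_iff_odd.mpr hm) h2
    have h2 : padicValInt 2 (2 ^ k) = k := by
      have : (2:ℤ)^k = ((2^k : ℕ) : ℤ) := by push_cast; rfl
      rw [this, padicValInt.of_nat, padicValNat.prime_pow]
    rw [h1, h2, add_zero]
  change Even (padicValInt 2 (2 ^ k * m)) ↔ _
  rw [this]

lemma zero_E : (0:ℤ) ∈ E := by change Even (padicValInt 2 0); simp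

lemma int_decomp {n : ℤ} (hn : n ≠ 0) : ∃ (k : ℕ) (m : ℤ), Odd m ∧ n = 2 ^ k * m := by
  obtain ⟨k, m, hm, h⟩ := Nat.exists_eq_two_pow_mul_odd (n := n.natAbs) (by simpa using hn)
  rcases Int.natAbs_eq n with h' | h'
  · exact ⟨k, m, by exact_mod_cast hm, by rw [h', h]; push_cast; rfl⟩
  · exact ⟨k, -m, Odd.neg (by exact_mod_cast hm), by rw [h', h]; push_cast; ring⟩

lemma toeplitz {K : ℕ} (hK : Even K) {n m : ℤ} (hn : |n| < 2 ^ K)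
    (hm : (2:ℤ) ^ (K+1) ∣ m - 2 ^ K) : (n ∈ E ↔ n + m ∈ E) := by
  obtain ⟨q, hq⟩ := hm
  have hm' : m = 2 ^ K * (2 * q + 1) := by rw [pow_succ] at hq; linarith
  have ho : Odd (2 * q + 1) := ⟨q, rfl⟩
  by_cases h0 : n = 0
  · subst h0
    rw [zero_add, hm', E_iff K ho]
    simp [hK, zero_E]
  · obtain ⟨a, b, hb, rfl⟩ := int_decomp h0
    have haK : a < K := by
      by_contra hc
      have hb1 : 1 ≤ |b| := Int.one_le_abs (by rintro rfl; simp at h0)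
      rw [abs_mul, abs_pow, abs_two] at hn
      have : (2:ℤ)^K ≤ 2 ^ a := pow_le_pow_right₀ (by norm_num) (by omega)
      have h3 : (2:ℤ) ^ a * 1 ≤ 2 ^ a * |b| := by gcongr
      linarith
    obtain ⟨d, rfl⟩ : ∃ d, K = a + (d + 1) := ⟨K - a - 1, by omega⟩
    have e : 2 ^ a * b + m = 2 ^ a * (b + 2 * (2 ^ d * (2 * q + 1))) := by
      rw [hm']; ring
    rw [e, E_iff a hb, E_iff a]
    exact hb.add_even (even_two_mul _)

lemma E_E {k : ℕ} : (if Even k then E else Eᶜ) ∈ D.Sn D.H := by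
  split_ifs
  · exact D.E_mem
  · exact D.Sn_compl D.E_mem

lemma cls_mem (k : ℕ) : {n : ℤ | (2:ℤ) ^ (k+2) ∣ n} ∈ D.Sn D.H := by
  induction k with
  | zero =>
    intro φ hφ c
    have h1 : ({n : ℤ | (2:ℤ) ^ (0+2) ∣ n}) ∈ D.Sn D.H ∨ True := Or.inr trivial
    by_cases h4 : (4:ℤ) ∣ c
    · have : D.bb c {n : ℤ | (2:ℤ) ^ (0+2) ∣ n} = D.bb c Set.univ := by
        apply D.bb_congr (by simp)
        intro n hn
        simp only [Set.mem_ofPred_eq, Set.mem_univ, iff_true]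
        norm_num
        have := dvd_add hn h4
        simpa using this
      rw [this]; exact D.univ_mem φ hφ c
    · have : D.bb c {n : ℤ | (2:ℤ) ^ (0+2) ∣ n} = 1 := by
        have e : D.bb c {n : ℤ | (2:ℤ) ^ (0+2) ∣ n} = D.bb c ∅ := by
          apply D.bb_congr (by simp)
          intro n hn
          simp only [Set.mem_ofPred_eq, Set.mem_empty_iff_false, iff_false]
          norm_num
          intro h
          apply h4
          have := dvd_sub h hn
          simpa using this
        rw [e, ← Set.compl_univ, bb_compl, mul_inv_cancel]
      rw [this]; simp
  | succ k ih =>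
    set E' : Set ℤ := if Even (k+2) then E else Eᶜ with hE'
    have hodd : ∀ m : ℤ, Odd m → 2 ^ (k+2) * m ∈ E' := by
      intro m hm
      have := E_iff (k+2) hm
      rw [hE']
      split_ifs with h
      · exact this.mpr h
      · exact fun h' => h (this.mp h')
    have heven : ∀ m : ℤ, Odd m → 2 ^ (k+3) * m ∉ E' := by
      intro m hm
      have := E_iff (k+3) hm
      rw [hE']
      split_ifs with h
      · intro h'
        have := this.mp h'
        rw [show k + 3 = (k+2) + 1 by ring, Nat.even_add_one] at this
        exact this h
      · intro h'
        apply h'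
        rw [this, show k + 3 = (k+2) + 1 by ring, Nat.even_add_one]
        exact h
    have hE : E' ∈ D.Sn D.H := D.E_E
    have hB := D.Sn_compl (D.Sn_inter D.H_norm hE (D.Sn_shift D.H_norm hE (2 ^ (k+3))))
    have := D.Sn_inter D.H_norm ih hB
    convert this using 1
    ext n
    simp only [Set.mem_ofPred_eq, Set.mem_inter_iff, Set.mem_compl_iff]
    constructor
    · rintro ⟨m, rfl⟩
      refine ⟨⟨2 * m, by ring⟩, ?_⟩
      rintro ⟨h1, h2⟩
      rcases Int.even_or_odd m with hm | hm
      · apply heven (m+1) hm.add_one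
        convert h2 using 1; ring
      · apply heven m hm
        convert h1 using 1
    · rintro ⟨⟨m, rfl⟩, h⟩
      rcases Int.even_or_odd m with ⟨l, hm⟩ | hm
      · exact ⟨l, by rw [hm]; ring⟩
      · exfalso
        apply h
        refine ⟨hodd m hm, ?_⟩
        have := hodd (m + 2) (hm.add_even even_two)
        convert this using 1; ring

/-- Locality of a permutation. -/
def Lcl (R : ℤ) (h : Perm Ω) : Prop := 0 ≤ R ∧ ∀ x, |D.fl (h x) - D.fl x| ≤ R ∧ ∀ m, (4:ℤ) ∣ m →
  (∀ i, |i| ≤ R → (D.fl x + i ∈ E ↔ D.fl x + i + m ∈ E)) → h ((D.t ^ m) x) = (D.t ^ m) (h x)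

variable {D}

lemma Lcl.mul {R S : ℤ} {h k : Perm Ω} (hh : D.Lcl R h) (hk : D.Lcl S k) :
    D.Lcl (R + S) (h * k) := by
  refine ⟨add_nonneg hh.1 hk.1, fun x => ⟨?_, fun m hm hE => ?_⟩⟩
  · have h1 := (hh.2 (k x)).1
    have h2 := (hk.2 x).1
    rw [Perm.mul_apply]
    rw [abs_le] at *
    constructor <;> linarith [h1.1, h1.2, h2.1, h2.2]
  · rw [Perm.mul_apply, Perm.mul_apply, (hk.2 x).2 m hm, (hh.2 (k x)).2 m hm]
    · intro i hi
      have h2 := (hk.2 x).1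
      have := hE (D.fl (k x) - D.fl x + i) ((abs_add_le _ _).trans (by linarith))
      rw [show D.fl x + (D.fl (k x) - D.fl x + i) = D.fl (k x) + i by ring] at this
      exact this
    · intro i hi
      exact hE i (hi.trans (by linarith [hh.1]))

lemma Lcl.inv {R : ℤ} {h : Perm Ω} (hh : D.Lcl R h) : D.Lcl (2 * R) h⁻¹ := by
  refine ⟨by linarith [hh.1], fun x => ?_⟩
  obtain ⟨y, rfl⟩ : ∃ y, h y = x := ⟨h⁻¹ x, by simp⟩
  have e : h⁻¹ (h y) = y := by simp
  rw [e]
  have h2 := (hh.2 y).1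
  refine ⟨?_, fun m hm hE => ?_⟩
  · rw [abs_sub_comm]; exact h2.trans (by linarith [hh.1])
  · rw [Perm.inv_eq_iff_eq, (hh.2 y).2 m hm]
    intro i hi
    have := hE (D.fl y - D.fl (h y) + i) ((abs_add_le _ _).trans (by rw [abs_sub_comm]; linarith))
    rw [show D.fl (h y) + (D.fl y - D.fl (h y) + i) = D.fl y + i by ring] at this
    exact this

variable (D)

lemma Φ_commute {φ : Perm Ω} (hφ : φ ∈ D.Φ) {m : ℤ} (hm : (4:ℤ) ∣ m) : Commute φ (D.t ^ m) := by
  obtain ⟨k, rfl⟩ := hm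
  rw [zpow_mul]
  exact (D.Φ_comm φ hφ).zpow_right k

lemma Lcl_Φ {φ : Perm Ω} (hφ : φ ∈ D.Φ) : D.Lcl 0 φ := by
  refine ⟨le_rfl, fun x => ⟨by simp [D.Φ_fl φ hφ], fun m hm _ => ?_⟩⟩
  rw [← Perm.mul_apply, (D.Φ_commute hφ hm).eq, Perm.mul_apply]

lemma bj_shift (n m : ℤ) (x : Ω) : D.bj (n + m) ((D.t ^ m) x) = (D.t ^ m) (D.bj n x) := by
  rw [← Perm.mul_apply, ← Perm.mul_apply]
  congr 1
  unfold bj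
  rw [add_comm n m, ← conj_conj]
  group

lemma Lcl_bb {A : Set ℤ} (hA : A ∈ ({Set.univ, E} : Set (Set ℤ))) (c : ℤ) :
    D.Lcl 4 (D.bb c A) := by
  classical
  refine ⟨by norm_num, fun x => ?_⟩
  have b1 := start_le c 0 (M := 4) (by norm_num) (D.fl x)
  have b2 := lt_start c 0 (M := 4) (by norm_num) (D.fl x)
  have b3 := start_dvd c 0 4 (D.fl x)
  set n := start c 0 4 (D.fl x) with hn
  have e : D.bb c A x = if n ∈ A then D.bj n x else x :=
    bb_apply D b3 (by linarith) (by linarith)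
  refine ⟨?_, fun m hm hE => ?_⟩
  · have w := D.spf_window (c := c) (p := 0) (M := 4) (by norm_num)
      (D.fam ⟨D.β, D.β_W4⟩ 0 A) x
    change _ ≤ D.fl (D.bb c A x) ∧ D.fl (D.bb c A x) < _ at w
    rw [← hn] at w
    rw [abs_le]; constructor <;> linarith [w.1, w.2]
  · have f : (D.fl ((D.t ^ m) x)) = D.fl x + m := D.fl_zpow m x
    rw [bb_apply D (n := n + m) (x := (D.t ^ m) x), e]
    · have : (n + m ∈ A ↔ n ∈ A) := by
        rcases hA with rfl | rfl
        · simp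
        · have := hE (n - D.fl x) (by rw [abs_le]; constructor <;> linarith)
          rw [show D.fl x + (n - D.fl x) = n by ring] at this
          exact this.symm
      simp only [this]
      split_ifs
      · exact D.bj_shift n m x
      · rfl
    · rw [show n + m - c = (n - c) + m by ring]; exact dvd_add b3 hm
    · linarith
    · linarith

lemma H_Lcl {h : Perm Ω} (hh : h ∈ D.H) : ∃ R, D.Lcl R h := by
  induction hh using Subgroup.closure_induction with
  | mem x hx =>
    obtain ⟨φ, hφ, c, hc, A, hA, rfl⟩ := hx
    exact ⟨_, ((D.Lcl_Φ hφ).mul (D.Lcl_bb hA c)).mul (D.Lcl_Φ hφ).inv⟩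
  | one => exact ⟨_, D.Lcl_Φ D.one_mem⟩
  | mul x y _ _ hx hy =>
    obtain ⟨R, hR⟩ := hx
    obtain ⟨S, hS⟩ := hy
    exact ⟨_, hR.mul hS⟩
  | inv x _ hx =>
    obtain ⟨R, hR⟩ := hx
    exact ⟨_, hR.inv⟩

end Dat
end FE

namespace FE
open Equiv
namespace Dat
variable {Ω : Type} [LinearOrder Ω] (D : Dat Ω)

lemma conjΦ_W {φ : Perm Ω} (hφ : φ ∈ D.Φ) {p M : ℤ} {s : Perm Ω} (hs : s ∈ D.W p M) :
    φ * s * φ⁻¹ ∈ D.W p M := by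
  intro x hx
  obtain ⟨y, rfl⟩ : ∃ y, φ y = x := ⟨φ⁻¹ x, by simp⟩
  rw [D.Φ_fl φ hφ] at hx
  simp [hs y hx]

lemma Sp_conj {φ : Perm Ω} (hφ : φ ∈ D.Φ) {c p M : ℤ} (hM : 0 < M) (hc : (4:ℤ) ∣ c)
    (h4 : (4:ℤ) ∣ M) (σ : ℤ → D.W p M) :
    D.Sp c p hM (fun n => ⟨φ * σ n * φ⁻¹, D.conjΦ_W hφ (σ n).2⟩) = φ * D.Sp c p hM σ * φ⁻¹ := by
  ext x
  obtain ⟨y, rfl⟩ : ∃ y, φ y = x := ⟨φ⁻¹ x, by simp⟩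
  have a1 := start_le c p hM (D.fl y)
  have a2 := lt_start c p hM (D.fl y)
  have a3 := start_dvd c p M (D.fl y)
  set n := start c p M (D.fl y)
  have hf := D.Φ_fl φ hφ y
  have hn : (4:ℤ) ∣ n := by
    have := dvd_add (h4.trans a3) hc
    simpa using this
  rw [Sp_apply_of D hM _ a3 (by rw [hf]; linarith) (by rw [hf]; linarith)]
  have e : (φ * D.Sp c p hM σ * φ⁻¹) (φ y) = φ (D.Sp c p hM σ y) := by simp
  rw [e, Sp_apply_of D hM _ a3 (by linarith) (by linarith)]
  have k1 := (D.Φ_commute hφ hn).eq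
  have k2 := (D.Φ_commute hφ (m := -n) (by simpa using hn)).eq
  have : D.t ^ n * (φ * (σ n : Perm Ω) * φ⁻¹) * D.t ^ (-n) * φ =
      φ * (D.t ^ n * (σ n : Perm Ω) * D.t ^ (-n)) := by
    rw [mul_assoc _ (D.t ^ (-n)) φ, ← k2]
    rw [← mul_assoc φ, ← mul_assoc φ, k1]
    group
  exact DFunLike.congr_fun this y

/-- Constant spreading. -/
def SpC (c p : ℤ) {M : ℤ} (hM : 0 < M) : D.W p M →* Perm Ω :=
  (D.Sp c p hM).comp (Pi.constMonoidHom ℤ (D.W p M))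

lemma SpC_apply (c p : ℤ) {M : ℤ} (hM : 0 < M) (s : D.W p M) (x : Ω) :
    D.SpC c p hM s x = (D.t ^ (start c p M (D.fl x)) * (s : Perm Ω) *
      D.t ^ (-(start c p M (D.fl x)))) x := rfl

lemma SpC_gen {φ : Perm Ω} (hφ : φ ∈ D.Φ) {c p M j : ℤ} (hM : 0 < M) (hc : (4:ℤ) ∣ c)
    (h4 : (4:ℤ) ∣ M) (h1 : p ≤ j) (h2 : j + 2 ≤ p + M)
    (hs : φ * D.bj j * φ⁻¹ ∈ D.W p M) :
    D.SpC c p hM ⟨φ * D.bj j * φ⁻¹, hs⟩ = φ * D.bb (c + j) {n | M ∣ n - c - j} * φ⁻¹ := by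
  have hb : D.bj j ∈ D.W p M := D.W_le h1 h2 (D.bj_W j)
  have t := D.tile (c := c) hM h4 h1 h2 hb Set.univ
  have : D.fam ⟨D.bj j, hb⟩ j Set.univ = fun _ => ⟨D.bj j, hb⟩ := by funext n; simp [fam]
  rw [this] at t
  have k := D.Sp_conj hφ hM hc h4 (fun _ => ⟨D.bj j, hb⟩)
  rw [t] at k
  simp only [Set.mem_univ, true_and] at k
  exact k

/-- Finitely supported bumps. -/
def Loc : Subgroup (Perm Ω) := Subgroup.closure {g | ∃ φ ∈ D.Φ, ∃ j, g = φ * D.bj j * φ⁻¹}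

/-- Bumps supported in `[-w, w)`. -/
def LocW (w : ℤ) : Subgroup (Perm Ω) :=
  Subgroup.closure {g | ∃ φ ∈ D.Φ, ∃ j, -w ≤ j ∧ j + 2 ≤ w ∧ g = φ * D.bj j * φ⁻¹}

lemma exists_w {s : Perm Ω} (hs : s ∈ D.Loc) : ∃ w0, ∀ w, w0 ≤ w → s ∈ D.LocW w := by
  induction hs using Subgroup.closure_induction with
  | mem x hx =>
    obtain ⟨φ, hφ, j, rfl⟩ := hx
    refine ⟨|j| + 2, fun w hw => Subgroup.subset_closure ⟨φ, hφ, j, ?_, ?_, rfl⟩⟩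
    · linarith [neg_abs_le j]
    · linarith [le_abs_self j]
  | one => exact ⟨0, fun w _ => Subgroup.one_mem _⟩
  | mul x y _ _ hx hy =>
    obtain ⟨R, hR⟩ := hx
    obtain ⟨S, hS⟩ := hy
    exact ⟨max R S, fun w hw => mul_mem (hR w ((le_max_left _ _).trans hw))
      (hS w ((le_max_right _ _).trans hw))⟩
  | inv x _ hx =>
    obtain ⟨R, hR⟩ := hx
    exact ⟨R, fun w hw => inv_mem (hR w hw)⟩

lemma cls_shift (K : ℕ) (hK : 2 ≤ K) (a b : ℤ) : {n : ℤ | (2:ℤ) ^ K ∣ n - a - b} ∈ D.Sn D.H := by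
  obtain ⟨k, rfl⟩ : ∃ k, K = k + 2 := ⟨K - 2, by omega⟩
  have := D.Sn_shift D.H_norm (D.cls_mem k) (-a-b)
  convert this using 2
  ext n
  simp only [Set.mem_ofPred_eq]
  rw [show n + (-a - b) = n - a - b by ring]

lemma four_dvd {K : ℕ} (hK : 2 ≤ K) : (4:ℤ) ∣ 2 ^ K := by
  obtain ⟨k, rfl⟩ : ∃ k, K = k + 2 := ⟨K - 2, by omega⟩
  exact ⟨2 ^ k, by ring⟩

lemma LocW_H {K : ℕ} (hK : 2 ≤ K) (hM : (0:ℤ) < 2 ^ (K+1)) {s : Perm Ω}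
    (hs : s ∈ D.LocW (2 ^ K)) :
    ∃ hw : s ∈ D.W (-2 ^ K) (2 ^ (K+1)), D.SpC (2 ^ K) (-2 ^ K) hM ⟨s, hw⟩ ∈ D.H := by
  have : D.LocW (2 ^ K) ≤ (D.H.comap (D.SpC (2 ^ K) (-2 ^ K) hM)).map (Subgroup.subtype _) := by
    unfold LocW
    rw [Subgroup.closure_le]
    rintro _ ⟨φ, hφ, j, h1, h2, rfl⟩
    have h2' : j + 2 ≤ -2 ^ K + 2 ^ (K+1) := by rw [pow_succ]; linarith
    have hw : φ * D.bj j * φ⁻¹ ∈ D.W (-2 ^ K) (2 ^ (K+1)) :=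
      D.conjΦ_W hφ (D.W_le h1 h2' (D.bj_W j))
    refine ⟨⟨_, hw⟩, ?_, rfl⟩
    change D.SpC (2 ^ K) (-2 ^ K) hM ⟨_, hw⟩ ∈ D.H
    rw [SpC_gen D hφ hM (four_dvd hK) (four_dvd (by omega)) h1 h2']
    exact D.cls_shift (K+1) (by omega) _ _ φ hφ _
  obtain ⟨⟨s', hw⟩, h1, h2⟩ := this hs
  change s' = s at h2
  subst h2
  exact ⟨hw, h1⟩

lemma inv_mono {s : Perm Ω} (hs : StrictMono s) : StrictMono (s⁻¹ : Perm Ω) := by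
  intro a b hab
  rw [← hs.lt_iff_lt]; simpa using hab

lemma bb_mono (c : ℤ) (A : Set ℤ) : StrictMono (D.bb c A) := by
  apply Sp_mono
  intro n
  unfold fam
  split_ifs
  · exact D.β_mono
  · exact fun a b h => h

lemma H_mono {h : Perm Ω} (hh : h ∈ D.H) : StrictMono h := by
  induction hh using Subgroup.closure_induction with
  | mem x hx =>
    obtain ⟨φ, hφ, c, hc, A, hA, rfl⟩ := hx
    exact ((D.Φ_mono φ hφ).comp (D.bb_mono c A)).comp (inv_mono (D.Φ_mono φ hφ))
  | one => exact fun a b h => h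
  | mul x y _ _ hx hy => exact hx.comp hy
  | inv x _ hx => exact inv_mono hx

lemma bb_empty (c : ℤ) : D.bb c ∅ = 1 := by
  rw [← Set.compl_univ, bb_compl, mul_inv_cancel]

/-- One bump class generates everything. -/
lemma top_of_cls {N : Subgroup (Perm Ω)} (hN : ∀ h ∈ D.H, ∀ n ∈ N, h * n * h⁻¹ ∈ N)
    {M : ℤ} (hM : 0 < M) (h4 : (4:ℤ) ∣ M) (a : ℤ)
    (h : ∀ φ ∈ D.Φ, φ * D.bb a {n | M ∣ n - a} * φ⁻¹ ∈ N) : D.H ≤ N := by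
  have h1 : {n : ℤ | M ∣ n - a} ∈ D.Sn N := by
    intro φ hφ c
    by_cases hc : (4:ℤ) ∣ c - a
    · rw [D.bb_congr hc (A' := {n | M ∣ n - a}) (fun _ _ => Iff.rfl)]
      exact h φ hφ
    · rw [D.bb_congr (c' := c) (A' := ∅) (by simp), bb_empty]
      · simp
      · intro n hn
        simp only [Set.mem_ofPred_eq, Set.mem_empty_iff_false, iff_false]
        intro hd
        apply hc
        have := dvd_sub (h4.trans hd) hn
        simpa using this
  have h2 : ∀ r : ℕ, (r:ℤ) ≤ M → {n : ℤ | (n - a) % M < r} ∈ D.Sn N := by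
    intro r
    induction r with
    | zero =>
      intro _ φ hφ c
      have : {n : ℤ | (n - a) % M < (0:ℕ)} = ∅ := by
        ext n
        have := Int.emod_nonneg (n - a) hM.ne'
        simpa using this
      rw [this, bb_empty]; simp
    | succ r ih =>
      intro hr
      push_cast at hr
      have := D.Sn_union (ih (by linarith)) (D.Sn_shift hN h1 (-r)) ?_
      · convert this using 1
        ext n
        simp only [Set.mem_ofPred_eq, Set.mem_union]
        push_cast
        rw [Int.lt_add_one_iff, le_iff_lt_or_eq]
        apply or_congr_right
        rw [← Int.emod_emod_of_dvd (n - a) (dvd_refl M)]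
        constructor
        · intro hh
          rw [Int.emod_emod] at hh
          rw [show n + -(r:ℤ) - a = (n - a) - r by ring, ← hh]
          exact Int.dvd_self_sub_emod
        · intro hh
          rw [Int.emod_emod]
          rw [show n + -(r:ℤ) - a = (n - a) - r by ring] at hh
          rw [Int.emod_eq_emod_iff_emod_sub_eq_zero.mpr (Int.emod_eq_zero_of_dvd hh)]
          exact Int.emod_eq_of_lt (by positivity) (by linarith)
      · rw [Set.disjoint_left]
        intro n hn hn'
        simp only [Set.mem_ofPred_eq] at hn hn'
        rw [show n + -(r:ℤ) - a = (n - a) - r by ring] at hn'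
        rw [Int.emod_eq_emod_iff_emod_sub_eq_zero.mpr (Int.emod_eq_zero_of_dvd hn'),
          Int.emod_eq_of_lt (by positivity) (by linarith)] at hn
        exact lt_irrefl _ hn
  have h3 : Set.univ ∈ D.Sn N := by
    have := h2 M.toNat (by omega)
    convert this using 1
    ext n
    have := Int.emod_lt_of_pos (n - a) hM
    simp only [Set.mem_ofPred_eq, Set.mem_univ, true_iff]
    omega
  unfold H
  rw [Subgroup.closure_le]
  rintro _ ⟨φ, hφ, c, hc, A, hA, rfl⟩
  have := D.Sn_inter hN h3 (D.gen_mem hA) φ hφ c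
  rwa [Set.univ_inter] at this

lemma comm_trick {N H : Subgroup (Perm Ω)} (hN : ∀ h ∈ H, ∀ n ∈ N, h * n * h⁻¹ ∈ N)
    {h p q : Perm Ω} (hh : h ∈ N) (hp : p ∈ H) (hq : q ∈ H) (V : Set Ω)
    (hV : ∀ x ∈ V, h x ∉ V) (hpV : ∀ x, x ∉ V → p x = x) (hqV : ∀ x, x ∉ V → q x = x) :
    p * q * p⁻¹ * q⁻¹ ∈ N := by
  set k := h * p⁻¹ * h⁻¹ with hk
  have hc : k * q = q * k := by
    have : Perm.Disjoint k q := by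
      intro x
      by_cases hx : x ∈ V
      · left
        have h1 : h⁻¹ x ∉ V := fun h' => hV _ h' (by simpa using hx)
        have h2 : p⁻¹ (h⁻¹ x) = h⁻¹ x := by
          rw [Perm.inv_eq_iff_eq]; exact (hpV _ h1).symm
        change h (p⁻¹ (h⁻¹ x)) = x
        rw [h2]; simp
      · right; exact hqV x hx
    exact this.commute.eq
  have e : p * q * p⁻¹ * q⁻¹ = (p * k) * (q * (p * k)⁻¹ * q⁻¹) := by
    have : k * q * k⁻¹ = q := by rw [hc]; group
    calc p * q * p⁻¹ * q⁻¹ = p * (k * q * k⁻¹) * p⁻¹ * q⁻¹ := by rw [this]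
      _ = _ := by group
  have hpk : p * k ∈ N := by
    have := mul_mem (hN p hp h hh) (inv_mem hh)
    convert this using 1; rw [hk]; group
  rw [e]
  exact mul_mem hpk (hN q hq _ (inv_mem hpk))

lemma key_abs {N H : Subgroup (Perm Ω)} (hN : ∀ h ∈ H, ∀ n ∈ N, h * n * h⁻¹ ∈ N)
    {h : Perm Ω} (hh : h ∈ N) (V : Set Ω) (hV : ∀ x ∈ V, h x ∉ V)
    {W' : Type} [Group W'] (F : W' →* Perm Ω) (σ a b : W') (hσ : F σ ∈ H) (ha : F a ∈ H)
    (hb : F b ∈ H) (h1 : ∀ x, x ∉ V → F (σ * a * σ⁻¹) x = x)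
    (h2 : ∀ x, x ∉ V → F (σ * b * σ⁻¹) x = x) : F (a * b * a⁻¹ * b⁻¹) ∈ N := by
  have r := comm_trick hN hh
    (by rw [map_mul, map_mul, map_inv]; exact mul_mem (mul_mem hσ ha) (inv_mem hσ))
    (by rw [map_mul, map_mul, map_inv]; exact mul_mem (mul_mem hσ hb) (inv_mem hσ))
    V hV h1 h2
  have r' := hN _ (inv_mem hσ) _ r
  convert r' using 1
  simp only [map_mul, map_inv]
  group

lemma exists_K (B : ℤ) : ∃ K : ℕ, 2 ≤ K ∧ Even K ∧ B < 2 ^ K := by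
  refine ⟨2 * (B.toNat + 1), by omega, even_two_mul _, ?_⟩
  have h1 : B.toNat < 2 ^ (2 * (B.toNat + 1)) :=
    lt_of_lt_of_le (by omega) (Nat.lt_two_pow_self (n := 2 * (B.toNat + 1))).le
  have h2 : (B.toNat : ℤ) < 2 ^ (2 * (B.toNat + 1)) := by exact_mod_cast h1
  exact lt_of_le_of_lt (Int.self_le_toNat B) h2

theorem simple (CO : ∀ x d : Ω, x < d → ∃ s ∈ D.Loc, ∀ y, 0 ≤ D.fl y → D.fl y < 4 →
      x ≤ s y ∧ s y < d)
    (nomax : ∀ x, ∃ d, x < d ∧ D.fl d = D.fl x)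
    {N : Subgroup (Perm Ω)} (hNH : N ≤ D.H) (hN : ∀ h ∈ D.H, ∀ n ∈ N, h * n * h⁻¹ ∈ N)
    (hne : N ≠ ⊥) : D.H ≤ N := by
  obtain ⟨h, x0, hh, hx0⟩ : ∃ h x0, h ∈ N ∧ x0 < h x0 := by
    obtain ⟨⟨h, hh⟩, h1'⟩ := Subgroup.ne_bot_iff_exists_ne_one.mp hne
    have h1 : h ≠ 1 := fun q => h1' (Subtype.ext q)
    have : ∃ x, h x ≠ x := by
      by_contra hc
      push Not at hc
      exact h1 (Equiv.ext hc)
    obtain ⟨x, hx⟩ := this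
    rcases lt_or_gt_of_ne hx with hx | hx
    · exact ⟨h⁻¹, h x, inv_mem hh, by simpa using hx⟩
    · exact ⟨h, x, hh, hx⟩
  have hm := D.H_mono (hNH hh)
  obtain ⟨R, hR0, hR⟩ := D.H_Lcl (hNH hh)
  obtain ⟨d, hd1, hd2, hd3⟩ : ∃ d, x0 < d ∧ D.fl d = D.fl x0 ∧
      (D.fl (h x0) = D.fl x0 → d ≤ h x0) := by
    by_cases hf : D.fl (h x0) = D.fl x0
    · exact ⟨h x0, hx0, hf, fun _ => le_rfl⟩
    · obtain ⟨d, h1, h2⟩ := nomax x0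
      exact ⟨d, h1, h2, fun h => absurd h hf⟩
  obtain ⟨s, hs, hsU⟩ := CO x0 d hd1
  obtain ⟨w0, hw0⟩ := D.exists_w hs
  obtain ⟨K, hK2, hKe, hKB⟩ := exists_K (|D.fl x0| + R + |w0| + 4)
  have habs := abs_nonneg (D.fl x0)
  have habs' := abs_nonneg w0
  have hsW := hw0 (2 ^ K) (by linarith [le_abs_self w0])
  have hM : (0:ℤ) < 2 ^ (K+1) := by positivity
  have hMK : (2:ℤ) ^ (K+1) = 2 * 2 ^ K := by rw [pow_succ]; ring
  have hUfl : ∀ y, x0 ≤ y → y < d → D.fl y = D.fl x0 := fun y h1 h2 =>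
    le_antisymm ((D.fl_mono h2.le).trans hd2.le) (D.fl_mono h1)
  let V : Set Ω := {x | ∃ n, (2:ℤ) ^ (K+1) ∣ n - 2 ^ K ∧ x0 ≤ (D.t ^ (-n)) x ∧ (D.t ^ (-n)) x < d}
  have hV : ∀ x ∈ V, h x ∉ V := by
    rintro x ⟨n, hn, h1, h2⟩ ⟨n', hn', h3, h4⟩
    set y := (D.t ^ (-n)) x with hy
    have hxy : x = (D.t ^ n) y := by
      rw [hy, ← Perm.mul_apply, ← zpow_add]; simp
    have hy0 := hUfl y h1 h2
    have hloc : h x = (D.t ^ n) (h y) := by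
      rw [hxy]
      apply (hR y).2
      · have := dvd_add ((four_dvd (K := K+1) (by omega)).trans hn) (four_dvd hK2)
        simpa using this
      · intro i hi
        apply toeplitz hKe _ hn
        rw [hy0]
        exact (abs_add_le _ _).trans_lt (by linarith)
    rw [hloc, ← Perm.mul_apply, ← zpow_add] at h3 h4
    have hf := hUfl _ h3 h4
    rw [fl_zpow] at hf
    have hRy := (hR y).1
    rw [hy0] at hRy
    have hnn : n = n' := by
      obtain ⟨a, ha⟩ := hn
      obtain ⟨b, hb⟩ := hn'
      have e : n - n' = 2 ^ (K+1) * (a - b) := by rw [mul_sub, ← ha, ← hb]; ring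
      have hab : |2 ^ (K+1) * (a - b)| < (2:ℤ) ^ (K+1) := by
        rw [← e]
        have : |n - n'| = |D.fl (h y) - D.fl x0| := by
          rw [show n - n' = -(D.fl (h y) - D.fl x0) by linarith, abs_neg]
        rw [this]; linarith
      have := Int.eq_zero_of_abs_lt_dvd (Dvd.intro _ rfl) hab
      linarith
    rw [hnn] at h3 h4
    simp only [neg_add_cancel, zpow_zero, Perm.one_apply] at h3 h4
    have hle : h x0 ≤ h y := hm.monotone h1
    by_cases hf0 : D.fl (h x0) = D.fl x0
    · exact absurd (hd3 hf0) (not_le.mpr (hle.trans_lt h4))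
    · apply hf0
      apply le_antisymm
      · rw [← hUfl _ h3 h4]; exact D.fl_mono hle
      · exact D.fl_mono hx0.le
  have key : ∀ τ1 τ2 : Perm Ω, τ1 ∈ D.LocW (2 ^ K) → τ2 ∈ D.LocW (2 ^ K) → τ1 ∈ D.W 0 4 →
      τ2 ∈ D.W 0 4 → ∀ hw : τ1 * τ2 * τ1⁻¹ * τ2⁻¹ ∈ D.W (-2 ^ K) (2 ^ (K+1)),
        D.SpC (2 ^ K) (-2 ^ K) hM ⟨_, hw⟩ ∈ N := by
    intro τ1 τ2 h1 h2 w1 w2 hw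
    obtain ⟨hsw, hsH⟩ := D.LocW_H hK2 hM hsW
    obtain ⟨h1w, h1H⟩ := D.LocW_H hK2 hM h1
    obtain ⟨h2w, h2H⟩ := D.LocW_H hK2 hM h2
    have supp : ∀ τ (hτ : τ ∈ D.W (-2 ^ K) (2 ^ (K+1))), τ ∈ D.W 0 4 → ∀ x, x ∉ V →
        D.SpC (2 ^ K) (-2 ^ K) hM (⟨s, hsw⟩ * ⟨τ, hτ⟩ * ⟨s, hsw⟩⁻¹) x = x := by
      intro τ hτ w x hx
      rw [SpC_apply]
      set n := start (2 ^ K) (-2 ^ K) (2 ^ (K+1)) (D.fl x)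
      change (D.t ^ n) (s (τ (s⁻¹ ((D.t ^ (-n)) x)))) = x
      rw [w]
      · rw [show s (s⁻¹ ((D.t ^ (-n)) x)) = (D.t ^ (-n)) x by simp, ← Perm.mul_apply,
          ← zpow_add]; simp
      · rintro ⟨q1, q2⟩
        apply hx
        have := hsU _ q1 (by linarith)
        rw [show s (s⁻¹ ((D.t ^ (-n)) x)) = (D.t ^ (-n)) x by simp] at this
        exact ⟨n, start_dvd _ _ _ _, this⟩
    exact key_abs hN hh V hV (D.SpC (2 ^ K) (-2 ^ K) hM) ⟨s, hsw⟩ ⟨τ1, h1w⟩ ⟨τ2, h2w⟩ hsH h1H h2H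
      (supp _ h1w w1) (supp _ h2w w2)
  apply D.top_of_cls hN hM (four_dvd (by omega)) (2 ^ K + 1)
  intro φ hφ
  have h4K : (4:ℤ) ≤ 2 ^ K := by
    calc (4:ℤ) = 2 ^ 2 := by norm_num
      _ ≤ 2 ^ K := pow_le_pow_right₀ (by norm_num) hK2
  have hg : ∀ j, 0 ≤ j → j ≤ 2 → φ * D.bj j * φ⁻¹ ∈ D.LocW (2 ^ K) := fun j h0 h2 =>
    Subgroup.subset_closure ⟨φ, hφ, j, by linarith, by linarith, rfl⟩
  have hg' : ∀ j, 0 ≤ j → j ≤ 2 → φ * D.bj j * φ⁻¹ ∈ D.W 0 4 := fun j h0 h2 =>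
    D.conjΦ_W hφ (D.bj_W4 h0 h2)
  have e : (φ * D.bj 2 * φ⁻¹ * (φ * D.bj 1 * φ⁻¹) * (φ * D.bj 2 * φ⁻¹)⁻¹) * (φ * D.bj 0 * φ⁻¹) *
      (φ * D.bj 2 * φ⁻¹ * (φ * D.bj 1 * φ⁻¹) * (φ * D.bj 2 * φ⁻¹)⁻¹)⁻¹ * (φ * D.bj 0 * φ⁻¹)⁻¹ =
      φ * D.bj 1 * φ⁻¹ := by
    have := congrArg (MulAut.conj φ) (grp1 D.bj_comm D.ident')
    simpa only [map_mul, map_inv, MulAut.conj_apply] using this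
  have hw1 : φ * D.bj 1 * φ⁻¹ ∈ D.W (-2 ^ K) (2 ^ (K+1)) :=
    D.conjΦ_W hφ (D.W_le (by linarith) (by linarith) (D.bj_W 1))
  have r := key (φ * D.bj 2 * φ⁻¹ * (φ * D.bj 1 * φ⁻¹) * (φ * D.bj 2 * φ⁻¹)⁻¹) (φ * D.bj 0 * φ⁻¹)
    (mul_mem (mul_mem (hg 2 (by norm_num) (by norm_num)) (hg 1 (by norm_num) (by norm_num)))
      (inv_mem (hg 2 (by norm_num) (by norm_num)))) (hg 0 (by norm_num) (by norm_num))
    (mul_mem (mul_mem (hg' 2 (by norm_num) (by norm_num)) (hg' 1 (by norm_num) (by norm_num)))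
      (inv_mem (hg' 2 (by norm_num) (by norm_num)))) (hg' 0 (by norm_num) (by norm_num))
    (by rw [e]; exact hw1)
  simp only [e] at r
  rw [SpC_gen D hφ hM (four_dvd hK2) (four_dvd (by omega)) (by linarith) (by linarith)] at r
  simp only [sub_sub] at r
  exact r

end Dat
end FE

namespace FE
open Equiv

/-- A type synonym of `Ω` to be well-ordered. -/
def WO (Ω : Type) : Type := Ω

theorem lo_of_mono {Ω Γ : Type} [LinearOrder Ω] [Group Γ] (ρ : Γ →* Perm Ω)
    (hinj : Function.Injective ρ) (hm : ∀ g, StrictMono (ρ g)) :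
    ∃ l : LinearOrder Γ, ∀ a b c : Γ, l.le b c → l.le (a * b) (a * c) := by
  classical
  let _ : LinearOrder (WO Ω) := linearOrderOfSTO (WellOrderingRel (α := WO Ω))
  have : WellFoundedLT (WO Ω) := ⟨(WellOrderingRel.isWellOrder (α := WO Ω)).wf⟩
  let f : Γ → Lex (WO Ω → Ω) := fun g => toLex (fun x => ρ g x)
  have hf : Function.Injective f := by
    intro a b h
    apply hinj
    ext x
    exact congrFun (toLex.injective h) x
  refine ⟨LinearOrder.lift' f hf, ?_⟩
  intro a b c hbc
  change f b ≤ f c at hbc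
  change f (a * b) ≤ f (a * c)
  rcases hbc.eq_or_lt with h | h
  · rw [hf h]
  · apply le_of_lt
    have aux : ∀ (g : Γ) (x : Ω), ρ (a * g) x = ρ a (ρ g x) := by
      intro g x
      rw [map_mul, Perm.mul_apply]
    obtain ⟨i, h1, h2⟩ := h
    refine ⟨i, fun j hj => ?_, ?_⟩
    · have := h1 j hj
      change ρ b j = ρ c j at this
      exact (aux b j).trans ((congrArg (ρ a) this).trans (aux c j).symm)
    · change ρ b i < ρ c i at h2
      exact lt_of_eq_of_lt (aux b i) (lt_of_lt_of_eq (hm a h2) (aux c i).symm)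

namespace Dat
variable {Ω : Type} [LinearOrder Ω] (D : Dat Ω)

theorem H_lo : ∃ l : LinearOrder D.H, ∀ a b c : D.H, l.le b c → l.le (a * b) (a * c) :=
  lo_of_mono D.H.subtype (Subgroup.subtype_injective _) (fun g => D.H_mono g.2)

theorem H_fg : Group.FG D.H := by
  have : D.H.FG := ⟨D.gens_fin.toFinset, by simp [H]⟩
  exact (Group.fg_iff_subgroup_fg _).mpr this

theorem H_simple (CO : ∀ x d : Ω, x < d → ∃ s ∈ D.Loc, ∀ y, 0 ≤ D.fl y → D.fl y < 4 →
      x ≤ s y ∧ s y < d)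
    (nomax : ∀ x, ∃ d, x < d ∧ D.fl d = D.fl x) (hβ : ∃ x, D.β x ≠ x) : IsSimpleGroup D.H := by
  have hnt : Nontrivial D.H := by
    obtain ⟨x, hx⟩ := hβ
    have hf : 0 ≤ D.fl x ∧ D.fl x < 2 := by
      by_contra hc
      exact hx (D.β_supp x hc)
    have hm : D.bb 0 Set.univ ∈ D.H := by
      have := D.univ_mem 1 D.one_mem 0
      simpa using this
    refine ⟨⟨⟨_, hm⟩, 1, ?_⟩⟩
    intro h
    have h1 : D.bb 0 Set.univ = 1 := congrArg Subtype.val h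
    have h2 := D.bb_apply (c := 0) (A := Set.univ) (x := x) (n := 0) (by simp) hf.1 (by linarith)
    rw [h1] at h2
    simp [bj] at h2
    exact hx h2.symm
  refine ⟨fun n hn => ?_⟩
  by_cases hb : n = ⊥
  · left; exact hb
  · right
    have := D.simple CO nomax (N := n.map D.H.subtype) (Subgroup.map_subtype_le n) ?_ ?_
    · rw [eq_top_iff]
      intro h _
      obtain ⟨k, hk, he⟩ := this h.2
      have : k = h := Subtype.ext he
      rwa [← this]
    · rintro h hh _ ⟨k, hk, rfl⟩
      exact ⟨⟨h, hh⟩ * k * ⟨h, hh⟩⁻¹, hn.conj_mem k hk _, rfl⟩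
    · rwa [Ne, Subgroup.map_eq_bot_iff_of_injective _ (Subgroup.subtype_injective _)]

end Dat
end FE

namespace FE
open Equiv

/-- Dyadic rationals. -/
def Dy : AddSubgroup ℚ where
  carrier := {q | ∃ (n : ℕ) (k : ℤ), q * 2 ^ n = k}
  zero_mem' := ⟨0, 0, by simp⟩
  add_mem' := by
    rintro a b ⟨n, k, h⟩ ⟨m, l, h'⟩
    refine ⟨n + m, k * 2 ^ m + l * 2 ^ n, ?_⟩
    push_cast
    rw [← h, ← h', pow_add]; ring
  neg_mem' := by
    rintro a ⟨n, k, h⟩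
    exact ⟨n, -k, by push_cast; rw [← h]; ring⟩

/-- The dyadic line. -/
abbrev L : Type := Dy

lemma Dy_int (k : ℤ) : (k : ℚ) ∈ Dy := ⟨0, k, by simp⟩

lemma Dy_half {q : ℚ} (h : q ∈ Dy) : q / 2 ∈ Dy := by
  obtain ⟨n, k, h⟩ := h
  exact ⟨n + 1, k, by rw [← h, pow_succ]; ring⟩

lemma Dy_double {q : ℚ} (h : q ∈ Dy) : 2 * q ∈ Dy := by
  rw [two_mul]; exact add_mem h h

lemma Dy_one : (1:ℚ) ∈ Dy := by simpa using Dy_int 1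

/-- Bump on the rationals. -/
def bq (x : ℚ) : ℚ :=
  if x ≤ 0 then x else if x ≤ 1 / 2 then 2 * x else if x ≤ 1 then x + 1 / 2 else
    if x ≤ 2 then x / 2 + 1 else x

/-- Inverse bump. -/
def bqi (x : ℚ) : ℚ :=
  if x ≤ 0 then x else if x ≤ 1 then x / 2 else if x ≤ 3 / 2 then x - 1 / 2 else
    if x ≤ 2 then 2 * x - 2 else x

lemma bq1 {x : ℚ} (h : x ≤ 0) : bq x = x := by simp [bq, h]
lemma bq2 {x : ℚ} (h : 0 ≤ x) (h' : x ≤ 1/2) : bq x = 2 * x := by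
  unfold bq; split_ifs <;> linarith
lemma bq3 {x : ℚ} (h : 1/2 ≤ x) (h' : x ≤ 1) : bq x = x + 1/2 := by
  unfold bq; split_ifs <;> linarith
lemma bq4 {x : ℚ} (h : 1 ≤ x) (h' : x ≤ 2) : bq x = x / 2 + 1 := by
  unfold bq; split_ifs <;> linarith
lemma bq5 {x : ℚ} (h : 2 ≤ x) : bq x = x := by
  unfold bq; split_ifs <;> linarith

lemma bqi_bq (x : ℚ) : bqi (bq x) = x := by
  unfold bq; split_ifs <;> unfold bqi <;> split_ifs <;> linarith

lemma bq_bqi (x : ℚ) : bq (bqi x) = x := by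
  unfold bqi; split_ifs <;> unfold bq <;> split_ifs <;> linarith

lemma bq_mono : StrictMono bq := by
  intro x y h
  unfold bq; split_ifs <;> linarith

lemma bq_Dy {x : ℚ} (h : x ∈ Dy) : bq x ∈ Dy := by
  have h2 : (1:ℚ)/2 ∈ Dy := Dy_half Dy_one
  unfold bq; split_ifs
  · exact h
  · exact Dy_double h
  · exact add_mem h h2
  · exact add_mem (Dy_half h) Dy_one
  · exact h

lemma bqi_Dy {x : ℚ} (h : x ∈ Dy) : bqi x ∈ Dy := by
  have h2 : (1:ℚ)/2 ∈ Dy := Dy_half Dy_one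
  unfold bqi; split_ifs
  · exact h
  · exact Dy_half h
  · exact sub_mem h h2
  · exact sub_mem (Dy_double h) (by simpa using Dy_int 2)
  · exact h

/-- Bump on the dyadic line. -/
def βL : Perm L where
  toFun x := ⟨bq x, bq_Dy x.2⟩
  invFun x := ⟨bqi x, bqi_Dy x.2⟩
  left_inv x := Subtype.ext (bqi_bq _)
  right_inv x := Subtype.ext (bq_bqi _)

/-- Translation of the dyadic line. -/
def tL : Perm L := Equiv.addRight (⟨1, Dy_one⟩ : L)

lemma tL_coe (x : L) : ((tL x : L) : ℚ) = x + 1 := rfl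

lemma tL_zpow (n : ℤ) (x : L) : (((tL ^ n) x : L) : ℚ) = x + n := by
  induction n using Int.induction_on generalizing x with
  | zero => simp
  | succ n ih => rw [zpow_add_one, Perm.mul_apply, ih, tL_coe]; push_cast; ring
  | pred n ih =>
    rw [zpow_sub_one, Perm.mul_apply, ih]
    have := tL_coe (tL⁻¹ x)
    rw [show tL (tL⁻¹ x) = x by simp] at this
    rw [this]; push_cast; ring

lemma bjL_coe (j : ℤ) (x : L) :
    (((tL ^ j * βL * tL ^ (-j)) x : L) : ℚ) = bq (x - j) + j := by
  change (((tL ^ j) (βL ((tL ^ (-j)) x)) : L) : ℚ) = _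
  rw [tL_zpow]
  change bq ((((tL ^ (-j)) x : L)) : ℚ) + j = _
  rw [tL_zpow]; push_cast; ring_nf

lemma bq_ident (x : ℚ) : bq (bq (bq x - 1) + 1 - 2) + 2 =
    bq (bq (bq (bq (x - 1) + 1 - 2) + 2) - 1) + 1 := by
  rcases le_total x 0 with h0 | h0
  · simp (disch := grind) only [bq1]; ring
  rcases le_total x (1/2) with h1 | h1
  · simp (disch := grind) only [bq1, bq2]; ring_nf
  rcases le_total x 1 with h2 | h2
  · simp (disch := grind) only [bq1, bq2, bq3]; ring_nf
  rcases le_total x (3/2) with h3 | h3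
  · simp (disch := grind) only [bq1, bq2, bq3, bq4]; ring
  rcases le_total x 2 with h4 | h4
  · simp (disch := grind) only [bq2, bq3, bq4, bq5]; ring
  rcases le_total x 3 with h5 | h5
  · simp (disch := grind) only [bq2, bq3, bq4, bq5]; ring
  rcases le_total x 4 with h6 | h6
  · simp (disch := grind) only [bq2, bq3, bq4, bq5]; ring
  · simp (disch := grind) only [bq5]; ring

lemma identL : (tL ^ (2:ℤ) * βL * tL ^ (-2:ℤ)) * (tL ^ (1:ℤ) * βL * tL ^ (-1:ℤ)) * βL =
    (tL ^ (1:ℤ) * βL * tL ^ (-1:ℤ)) * βL * (tL ^ (2:ℤ) * βL * tL ^ (-2:ℤ)) *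
      (tL ^ (1:ℤ) * βL * tL ^ (-1:ℤ)) := by
  apply Equiv.ext
  intro x
  apply Subtype.ext
  change (((tL ^ (2:ℤ) * βL * tL ^ (-2:ℤ)) ((tL ^ (1:ℤ) * βL * tL ^ (-1:ℤ)) (βL x)) : L) : ℚ) =
    (((tL ^ (1:ℤ) * βL * tL ^ (-1:ℤ)) (βL ((tL ^ (2:ℤ) * βL * tL ^ (-2:ℤ))
      ((tL ^ (1:ℤ) * βL * tL ^ (-1:ℤ)) x))) : L) : ℚ)
  rw [bjL_coe, bjL_coe, bjL_coe]
  change _ = bq (bq ((((tL ^ (2:ℤ) * βL * tL ^ (-2:ℤ)) ((tL ^ (1:ℤ) * βL * tL ^ (-1:ℤ)) x) : L)) : ℚ)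
    - ((1:ℤ):ℚ)) + ((1:ℤ):ℚ)
  rw [bjL_coe, bjL_coe]
  change bq (bq (bq (x:ℚ) - ((1:ℤ):ℚ)) + ((1:ℤ):ℚ) - ((2:ℤ):ℚ)) + ((2:ℤ):ℚ) = _
  push_cast
  exact bq_ident x

/-- The data on the dyadic line. -/
def DL : Dat L where
  fl x := ⌊(x:ℚ)⌋
  t := tL
  β := βL
  fl_mono := fun x y h => Int.floor_mono (show (x:ℚ) ≤ y from h)
  fl_t := fun x => by rw [tL_coe, Int.floor_add_one]
  t_mono := fun x y h => by
    change (x:ℚ) < y at h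
    change (x:ℚ) + 1 < y + 1
    linarith
  β_mono := fun x y h => bq_mono (show (x:ℚ) < y from h)
  β_supp := fun x h => by
    apply Subtype.ext
    change bq x = x
    by_cases h0 : (x:ℚ) ≤ 0
    · exact bq1 h0
    · apply bq5
      push Not at h0
      have : (2:ℤ) ≤ ⌊(x:ℚ)⌋ := by
        by_contra hc
        exact h ⟨Int.floor_nonneg.mpr h0.le, by linarith⟩
      have := Int.le_floor.mp this
      exact_mod_cast this
  ident := identL
  Φ := {1}
  fin := Set.finite_singleton 1
  one_mem := rfl
  Φ_mono := by rintro _ rfl; exact fun a b h => h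
  Φ_fl := by rintro _ rfl _; rfl
  Φ_comm := by rintro _ rfl; exact Commute.one_left _

lemma DL_bj (j : ℤ) (x : L) : ((DL.bj j x : L) : ℚ) = bq (x - j) + j := bjL_coe j x

/-- Finite bump group on the dyadic line. -/
def Bs : Subgroup (Perm L) := Subgroup.closure {g | ∃ j, g = DL.bj j}

lemma bj_Bs (j : ℤ) : DL.bj j ∈ Bs := Subgroup.subset_closure ⟨j, rfl⟩

lemma bj_mono (j : ℤ) : StrictMono (DL.bj j) := by
  intro x y h
  change (x:ℚ) < y at h
  change ((DL.bj j x : L) : ℚ) < ((DL.bj j y : L) : ℚ)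
  rw [DL_bj, DL_bj]
  have := bq_mono (show (x:ℚ) - j < y - j by linarith)
  linarith

lemma Bs_mono {b : Perm L} (hb : b ∈ Bs) : StrictMono b := by
  induction hb using Subgroup.closure_induction with
  | mem x hx => obtain ⟨j, rfl⟩ := hx; exact bj_mono j
  | one => exact fun a b h => h
  | mul x y _ _ hx hy => exact hx.comp hy
  | inv x _ hx => exact Dat.inv_mono hx

/-- Integers in the line. -/
def iL (m : ℤ) : L := ⟨m, Dy_int m⟩

lemma to_int (x : L) : ∃ b ∈ Bs, ∃ m : ℤ, b x = iL m := by
  obtain ⟨n, k, h⟩ := x.2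
  induction n generalizing x k with
  | zero => exact ⟨1, one_mem _, k, Subtype.ext (by rw [pow_zero, mul_one] at h; exact h)⟩
  | succ n ih =>
    set v := ⌊(x:ℚ)⌋ with hv
    have h1 : (v:ℚ) ≤ x := Int.floor_le _
    have h2 : (x:ℚ) < v + 1 := Int.lt_floor_add_one _
    rcases le_total (x:ℚ) (v + 1/2) with hx | hx
    · have e : ((DL.bj v x : L) : ℚ) = 2 * x - v := by
        rw [DL_bj, bq2 (by linarith) (by linarith)]; ring
      obtain ⟨b, hb, m, hm⟩ := ih (DL.bj v x) (k - v * 2 ^ n) (by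
        rw [e]; push_cast; rw [← h, pow_succ]; ring)
      exact ⟨b * DL.bj v, mul_mem hb (bj_Bs v), m, hm⟩
    · have e : (((DL.bj (v-1))⁻¹ x : L) : ℚ) = 2 * x - v - 1 := by
        have hd : 2 * (x:ℚ) - v - 1 ∈ Dy :=
          sub_mem (sub_mem (Dy_double x.2) (Dy_int v)) Dy_one
        have : (DL.bj (v-1))⁻¹ x = ⟨_, hd⟩ := by
          rw [Perm.inv_eq_iff_eq]
          apply Subtype.ext
          rw [DL_bj]
          push_cast
          rw [bq4 (by linarith) (by linarith)]; ring
        rw [this]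
      obtain ⟨b, hb, m, hm⟩ := ih ((DL.bj (v-1))⁻¹ x) (k - (v + 1) * 2 ^ n) (by
        rw [e]; push_cast; rw [← h, pow_succ]; ring)
      exact ⟨b * (DL.bj (v-1))⁻¹, mul_mem hb (inv_mem (bj_Bs _)), m, hm⟩

lemma int_step (m : ℤ) : (DL.bj m * DL.bj (m-1)) (iL m) = iL (m+1) := by
  apply Subtype.ext
  rw [Perm.mul_apply, DL_bj, DL_bj]
  change bq (bq ((m:ℚ) - (m - 1 : ℤ)) + (m - 1 : ℤ) - m) + m = ((m + 1 : ℤ) : ℚ)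
  push_cast
  rw [bq3 (x := (m:ℚ) - (m - 1)) (by linarith) (by linarith), bq3 (by linarith) (by linarith)]
  ring

lemma int_zero (m : ℤ) : ∃ b ∈ Bs, b (iL 0) = iL m := by
  induction m using Int.induction_on with
  | zero => exact ⟨1, one_mem _, rfl⟩
  | succ n ih =>
    obtain ⟨b, hb, h⟩ := ih
    exact ⟨DL.bj n * DL.bj (n-1) * b, mul_mem (mul_mem (bj_Bs _) (bj_Bs _)) hb, by
      rw [Perm.mul_apply, h, int_step]⟩
  | pred n ih =>
    obtain ⟨b, hb, h⟩ := ih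
    refine ⟨(DL.bj (-n-1) * DL.bj (-n-1-1))⁻¹ * b,
      mul_mem (inv_mem (mul_mem (bj_Bs _) (bj_Bs _))) hb, ?_⟩
    rw [Perm.mul_apply, h, Perm.inv_eq_iff_eq, int_step]
    congr 1; ring

lemma Bs_trans (x y : L) : ∃ b ∈ Bs, b x = y := by
  obtain ⟨b, hb, m, hm⟩ := to_int x
  obtain ⟨b', hb', m', hm'⟩ := to_int y
  obtain ⟨e, he, h⟩ := int_zero m
  obtain ⟨e', he', h'⟩ := int_zero m'
  refine ⟨b'⁻¹ * (e' * (e⁻¹ * b)),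
    mul_mem (inv_mem hb') (mul_mem he' (mul_mem (inv_mem he) hb)), ?_⟩
  rw [Perm.mul_apply, Perm.inv_eq_iff_eq, hm', Perm.mul_apply, Perm.mul_apply, hm, ← h',
    ← h]
  simp

lemma push4 (k : ℕ) : ∃ b ∈ Bs, b (iL 4) = iL 4 ∧ ((b (iL 0) : L) : ℚ) = 4 - 1 / 2 ^ k := by
  have f4 : ∀ j : ℤ, j ≤ 2 → DL.bj j (iL 4) = iL 4 := by
    intro j hj
    have hj' : (j:ℚ) ≤ 2 := by exact_mod_cast hj
    apply Subtype.ext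
    rw [DL_bj]
    change bq (((4:ℤ):ℚ) - j) + j = ((4:ℤ):ℚ)
    push_cast
    rw [bq5 (by linarith)]; ring
  induction k with
  | zero =>
    refine ⟨(DL.bj 2 * DL.bj (2-1)) * ((DL.bj 1 * DL.bj (1-1)) * (DL.bj 0 * DL.bj (0-1))),
      mul_mem (mul_mem (bj_Bs _) (bj_Bs _)) (mul_mem (mul_mem (bj_Bs _) (bj_Bs _))
        (mul_mem (bj_Bs _) (bj_Bs _))), ?_, ?_⟩
    · simp only [Perm.mul_apply]
      rw [f4 (0-1) (by norm_num), f4 0 (by norm_num), f4 (1-1) (by norm_num), f4 1 (by norm_num),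
        f4 (2-1) (by norm_num), f4 2 (by norm_num)]
    · rw [Perm.mul_apply, Perm.mul_apply _ _ (iL 0), int_step, zero_add, int_step, one_add_one_eq_two,
        int_step]
      change (((2+1:ℤ)):ℚ) = _
      norm_num
  | succ k ih =>
    obtain ⟨b, hb, h1, h2⟩ := ih
    refine ⟨DL.bj 2 * b, mul_mem (bj_Bs 2) hb, by rw [Perm.mul_apply, h1, f4 2 le_rfl], ?_⟩
    rw [Perm.mul_apply, DL_bj, h2]
    have h3 : (0:ℚ) < 1 / 2 ^ k := by positivity
    have h4 : (1:ℚ) / 2 ^ k ≤ 1 := by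
      rw [div_le_one (by positivity)]; exact one_le_pow₀ (by norm_num)
    push_cast
    rw [bq4 (by linarith) (by linarith), pow_succ]
    field_simp
    ring

end FE

namespace FE
open Equiv

/-- Being an integer point of the line. -/
def isInt (ℓ : L) : Prop := ∃ v : ℤ, ℓ = iL v

lemma L_lt {x y : L} : x < y ↔ (x:ℚ) < y := Iff.rfl

/-- The dyadic points of the open unit interval. -/
abbrev Y0 : Type := {y : L // 0 < (y:ℚ) ∧ (y:ℚ) < 1}

/-- Shift a point of the unit interval by an integer. -/
def up (v : ℤ) (y : Y0) : L := (tL ^ v) y.1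

lemma up_coe (v : ℤ) (y : Y0) : ((up v y : L) : ℚ) = (y.1 : ℚ) + v := tL_zpow v y.1

lemma up_fl (v : ℤ) (y : Y0) : ⌊((up v y : L) : ℚ)⌋ = v := by
  rw [up_coe, Int.floor_eq_iff]
  have := y.2
  constructor <;> linarith [y.2.1, y.2.2]

lemma up_ni (v : ℤ) (y : Y0) : ¬ isInt (up v y) := by
  rintro ⟨w, hw⟩
  have h1 := up_fl v y
  have h2 := up_coe v y
  rw [hw] at h1 h2
  change ⌊((w:ℤ):ℚ)⌋ = v at h1
  change ((w:ℤ):ℚ) = _ at h2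
  rw [Int.floor_intCast] at h1
  subst h1
  linarith [y.2.1]

lemma exists_up {ℓ : L} (h : ¬ isInt ℓ) : ∃ y : Y0, ℓ = up ⌊(ℓ:ℚ)⌋ y := by
  have h1 := Int.floor_le (ℓ:ℚ)
  have h2 := Int.lt_floor_add_one (ℓ:ℚ)
  have h3 : ((⌊(ℓ:ℚ)⌋ : ℤ) : ℚ) ≠ ℓ := fun h' => h ⟨_, Subtype.ext h'.symm⟩
  have h4 := lt_of_le_of_ne h1 h3
  refine ⟨⟨(tL ^ (-⌊(ℓ:ℚ)⌋)) ℓ, ?_, ?_⟩, ?_⟩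
  · rw [tL_zpow]; push_cast; linarith
  · rw [tL_zpow]; push_cast; linarith
  · apply Subtype.ext
    rw [up_coe, tL_zpow]; push_cast; ring

/-- Fractional part of a non-integer. -/
noncomputable def fr (ℓ : L) (h : ¬ isInt ℓ) : Y0 := (exists_up h).choose

lemma up_fr (ℓ : L) (h : ¬ isInt ℓ) : up ⌊(ℓ:ℚ)⌋ (fr ℓ h) = ℓ := (exists_up h).choose_spec.symm

lemma up_inj {v : ℤ} {y y' : Y0} (h : up v y = up v y') : y = y' :=
  Subtype.ext ((tL ^ v).injective h)

lemma fr_up (v : ℤ) (y : Y0) (h) : fr (up v y) h = y := by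
  apply up_inj (v := v)
  have := up_fr (up v y) h
  rw [up_fl] at this
  exact this

lemma tL_up (v : ℤ) (y : Y0) : tL (up v y) = up (v+1) y := by
  apply Subtype.ext
  rw [tL_coe, up_coe, up_coe]; push_cast; ring

lemma up_lt {v : ℤ} {y y' : Y0} : up v y < up v y' ↔ y < y' := by
  rw [L_lt, up_coe, up_coe]
  constructor
  · intro h; exact (show (y.1:ℚ) < y'.1 by linarith)
  · intro h
    have : (y.1:ℚ) < y'.1 := h
    linarith

lemma lt_of_fl {x y : L} (h : ⌊(x:ℚ)⌋ < ⌊(y:ℚ)⌋) : x < y := by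
  by_contra hc
  have : (y:ℚ) ≤ x := not_lt.mp hc
  exact absurd (Int.floor_mono this) (not_le.mpr h)

/-- Splitting data for the line. -/
structure Mu (X : Type) [LinearOrder X] where
  m : L → X → L
  n : L → L
  k : L → X
  m_fl : ∀ ℓ x, ⌊((m ℓ x : L) : ℚ)⌋ = ⌊(ℓ:ℚ)⌋
  m_ni : ∀ ℓ x, ¬ isInt ℓ → ¬ isInt (m ℓ x)
  n_ni : ∀ ℓ, ¬ isInt ℓ → ¬ isInt (n ℓ)
  n_m : ∀ ℓ x, ¬ isInt ℓ → n (m ℓ x) = ℓ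
  k_m : ∀ ℓ x, ¬ isInt ℓ → k (m ℓ x) = x
  m_nk : ∀ ℓ, ¬ isInt ℓ → m (n ℓ) (k ℓ) = ℓ
  m_lt : ∀ ℓ ℓ' x x', ¬ isInt ℓ → ¬ isInt ℓ' → (ℓ < ℓ' ∨ (ℓ = ℓ' ∧ x < x')) → m ℓ x < m ℓ' x'
  m_t : ∀ ℓ x, ¬ isInt ℓ → m (tL ℓ) x = tL (m ℓ x)

instance : Countable L := by unfold L; infer_instance
instance : Countable Y0 := by unfold Y0; infer_instance

lemma mid_mem {a b : L} : ((a:ℚ) + b) / 2 ∈ Dy := Dy_half (add_mem a.2 b.2)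

instance : DenselyOrdered Y0 := ⟨fun a b h => by
  have h' : (a.1:ℚ) < b.1 := h
  refine ⟨⟨⟨((a.1:ℚ) + b.1) / 2, mid_mem⟩, ?_, ?_⟩, ?_, ?_⟩
  · change 0 < ((a.1:ℚ) + b.1) / 2; linarith [a.2.1, b.2.1]
  · change ((a.1:ℚ) + b.1) / 2 < 1; linarith [a.2.2, b.2.2]
  · change (a.1:ℚ) < ((a.1:ℚ) + b.1) / 2; linarith
  · change ((a.1:ℚ) + b.1) / 2 < (b.1:ℚ); linarith⟩

instance : NoMaxOrder Y0 := ⟨fun a => by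
  have h := a.2
  refine ⟨⟨⟨((a.1:ℚ) + 1) / 2, Dy_half (add_mem a.1.2 Dy_one)⟩, ?_, ?_⟩, ?_⟩
  · change 0 < ((a.1:ℚ) + 1) / 2; linarith [a.2.1]
  · change ((a.1:ℚ) + 1) / 2 < 1; linarith [a.2.2]
  · change (a.1:ℚ) < ((a.1:ℚ) + 1) / 2; linarith [a.2.2]⟩

instance : NoMinOrder Y0 := ⟨fun a => by
  have h := a.2
  refine ⟨⟨⟨(a.1:ℚ) / 2, Dy_half a.1.2⟩, ?_, ?_⟩, ?_⟩
  · change 0 < (a.1:ℚ) / 2; linarith [a.2.1]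
  · change (a.1:ℚ) / 2 < 1; linarith [a.2.1, a.2.2]
  · change (a.1:ℚ) / 2 < (a.1:ℚ); linarith [a.2.1]⟩

instance : Nonempty Y0 := ⟨⟨⟨1/2, Dy_half Dy_one⟩, by norm_num, by norm_num⟩⟩

lemma exists_e (X : Type) [LinearOrder X] [Countable X] [Nonempty X] [DenselyOrdered X]
    [NoMaxOrder X] : Nonempty ((Y0 ×ₗ X) ≃o Y0) := by
  haveI : Countable (Y0 ×ₗ X) := inferInstanceAs (Countable (Y0 × X))
  haveI : Nonempty (Y0 ×ₗ X) := inferInstanceAs (Nonempty (Y0 × X))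
  exact Order.iso_of_countable_dense _ _

theorem exists_Mu (X : Type) [LinearOrder X] [Countable X] [Nonempty X] [DenselyOrdered X]
    [NoMaxOrder X] : Nonempty (Mu X) := by
  classical
  obtain ⟨e⟩ := exists_e X
  let m : L → X → L := fun ℓ x =>
    if h : isInt ℓ then ℓ else up ⌊(ℓ:ℚ)⌋ (e (toLex (fr ℓ h, x)))
  let n : L → L := fun ℓ =>
    if h : isInt ℓ then ℓ else up ⌊(ℓ:ℚ)⌋ (ofLex (e.symm (fr ℓ h))).1
  let k : L → X := fun ℓ =>
    if h : isInt ℓ then Classical.arbitrary X else (ofLex (e.symm (fr ℓ h))).2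
  have hm : ∀ v y x, m (up v y) x = up v (e (toLex (y, x))) := by
    intro v y x
    simp only [m]
    rw [dif_neg (up_ni v y), up_fl, fr_up]
  have hn : ∀ v y, n (up v y) = up v (ofLex (e.symm y)).1 := by
    intro v y
    simp only [n]
    rw [dif_neg (up_ni v y), up_fl, fr_up]
  have hk : ∀ v y, k (up v y) = (ofLex (e.symm y)).2 := by
    intro v y
    simp only [k]
    rw [dif_neg (up_ni v y), fr_up]
  have hu : ∀ ℓ, ¬ isInt ℓ → ∃ v y, ℓ = up v y := fun ℓ h => ⟨_, exists_up h⟩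
  refine ⟨⟨m, n, k, ?_, ?_, ?_, ?_, ?_, ?_, ?_, ?_⟩⟩
  · intro ℓ x
    by_cases h : isInt ℓ
    · simp only [m]; rw [dif_pos h]
    · obtain ⟨v, y, rfl⟩ := hu ℓ h
      rw [hm, up_fl, up_fl]
  · intro ℓ x h
    obtain ⟨v, y, rfl⟩ := hu ℓ h
    rw [hm]; exact up_ni _ _
  · intro ℓ h
    obtain ⟨v, y, rfl⟩ := hu ℓ h
    rw [hn]; exact up_ni _ _
  · intro ℓ x h
    obtain ⟨v, y, rfl⟩ := hu ℓ h
    rw [hm, hn, e.symm_apply_apply]; rfl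
  · intro ℓ x h
    obtain ⟨v, y, rfl⟩ := hu ℓ h
    rw [hm, hk, e.symm_apply_apply]; rfl
  · intro ℓ h
    obtain ⟨v, y, rfl⟩ := hu ℓ h
    rw [hn, hk, hm]
    congr 1
    exact e.apply_symm_apply y
  · intro ℓ ℓ' x x' h h' hl
    obtain ⟨v, y, rfl⟩ := hu ℓ h
    obtain ⟨v', y', rfl⟩ := hu ℓ' h'
    rw [hm, hm]
    rcases lt_trichotomy v v' with hv | rfl | hv
    · apply lt_of_fl; rw [up_fl, up_fl]; exact hv
    · rw [up_lt, e.lt_iff_lt, Prod.Lex.toLex_lt_toLex]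
      rcases hl with hl | ⟨hl, hx⟩
      · left; exact up_lt.mp hl
      · right; exact ⟨up_inj hl, hx⟩
    · exfalso
      have : up v' y' < up v y := by apply lt_of_fl; rw [up_fl, up_fl]; exact hv
      rcases hl with hl | ⟨hl, hx⟩
      · exact lt_asymm hl this
      · exact absurd hl this.ne'
  · intro ℓ x h
    obtain ⟨v, y, rfl⟩ := hu ℓ h
    rw [tL_up, hm, hm, tL_up]

end FE

namespace FE
open Equiv

/-- The big line: a dyadic number and a sequence of labels. -/
@[ext] structure Om (X : Type) where
  l : L
  z : ℕ → X

section order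
variable {X : Type} [LinearOrder X]

noncomputable instance : LinearOrder (Om X) :=
  LinearOrder.lift' (fun a : Om X => (toLex (a.l, toLex a.z) : L ×ₗ Lex (ℕ → X))) (by
    intro a b h
    have h' := congrArg ofLex h
    have h1 := congrArg Prod.fst h'
    have h2 := congrArg Prod.snd h'
    exact Om.ext h1 h2)

lemma Om_lt {a b : Om X} : a < b ↔ a.l < b.l ∨ (a.l = b.l ∧
    ∃ i, (∀ j < i, a.z j = b.z j) ∧ a.z i < b.z i) := by
  change (toLex (a.l, toLex a.z) : L ×ₗ Lex (ℕ → X)) < toLex (b.l, toLex b.z) ↔ _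
  rw [Prod.Lex.toLex_lt_toLex]
  rfl

/-- Action on the first coordinate. -/
def ι (X : Type) : Perm L →* Perm (Om X) where
  toFun e :=
    { toFun := fun a => ⟨e a.l, a.z⟩
      invFun := fun a => ⟨e⁻¹ a.l, a.z⟩
      left_inv := fun a => by ext1 <;> simp
      right_inv := fun a => by ext1 <;> simp }
  map_one' := rfl
  map_mul' _ _ := rfl

lemma ι_apply (e : Perm L) (a : Om X) : ι X e a = ⟨e a.l, a.z⟩ := rfl

lemma ι_mono {e : Perm L} (he : StrictMono e) : StrictMono (ι X e) := by
  intro a b h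
  rw [Om_lt] at h ⊢
  rcases h with h | ⟨h, h'⟩
  · exact Or.inl (he h)
  · exact Or.inr ⟨congrArg e h, h'⟩

/-- Floor on the big line. -/
def flO (a : Om X) : ℤ := ⌊(a.l : ℚ)⌋

lemma Om_le_l {a b : Om X} (h : a ≤ b) : a.l ≤ b.l := by
  by_contra hc
  exact absurd (Om_lt.mpr (Or.inl (not_le.mp hc))) (not_lt.mpr h)

/-- Prepend to a sequence. -/
def cons (x : X) (z : ℕ → X) : ℕ → X := fun i => Nat.casesOn i x z

lemma cons_tail (z : ℕ → X) : cons (z 0) (fun i => z (i+1)) = z := by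
  funext i; cases i <;> rfl

variable (μ : Mu X)

open Classical in
/-- The absorbing map. -/
noncomputable def θ : Perm (Om X) where
  toFun a := if isInt a.l then a else ⟨μ.m a.l (a.z 0), fun i => a.z (i+1)⟩
  invFun a := if isInt a.l then a else ⟨μ.n a.l, cons (μ.k a.l) a.z⟩
  left_inv a := by
    by_cases h : isInt a.l
    · simp only [if_pos h]
    · simp only [if_neg h, if_neg (μ.m_ni _ _ h), μ.n_m _ _ h, μ.k_m _ _ h, cons_tail]
  right_inv a := by
    by_cases h : isInt a.l
    · simp only [if_pos h]
    · simp only [if_neg h, if_neg (μ.n_ni _ h)]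
      change (⟨μ.m (μ.n a.l) (μ.k a.l), a.z⟩ : Om X) = a
      rw [μ.m_nk _ h]

lemma θ_int {a : Om X} (h : isInt a.l) : θ μ a = a := if_pos h
lemma θ_ni {a : Om X} (h : ¬ isInt a.l) :
    θ μ a = ⟨μ.m a.l (a.z 0), fun i => a.z (i+1)⟩ := if_neg h
lemma θi_int {a : Om X} (h : isInt a.l) : (θ μ)⁻¹ a = a := if_pos h
lemma θi_ni {a : Om X} (h : ¬ isInt a.l) :
    (θ μ)⁻¹ a = ⟨μ.n a.l, cons (μ.k a.l) a.z⟩ := if_neg h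

lemma θ_fl (a : Om X) : flO (θ μ a) = flO a := by
  by_cases h : isInt a.l
  · rw [θ_int μ h]
  · rw [θ_ni μ h]; exact μ.m_fl _ _

lemma θi_fl (a : Om X) : flO ((θ μ)⁻¹ a) = flO a := by
  have := θ_fl μ ((θ μ)⁻¹ a)
  rw [show θ μ ((θ μ)⁻¹ a) = a by simp] at this
  exact this.symm

lemma int_fl {ℓ : L} (h : isInt ℓ) : (⌊(ℓ:ℚ)⌋ : ℚ) = ℓ := by
  obtain ⟨v, rfl⟩ := h
  change ((⌊((v:ℤ):ℚ)⌋ : ℤ) : ℚ) = ((v:ℤ):ℚ)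
  rw [Int.floor_intCast]

lemma int_le {ℓ ℓ' : L} (h : isInt ℓ) (h' : ⌊(ℓ:ℚ)⌋ ≤ ⌊(ℓ':ℚ)⌋) : (ℓ:ℚ) ≤ ℓ' := by
  rw [← int_fl h]
  exact le_trans (by exact_mod_cast h') (Int.floor_le _)

lemma θ_mono : StrictMono (θ μ) := by
  intro a b h
  by_cases ha : isInt a.l <;> by_cases hb : isInt b.l
  · rwa [θ_int μ ha, θ_int μ hb]
  · rw [θ_int μ ha, Om_lt]
    left
    have h1 : flO a ≤ flO (θ μ b) := by
      rw [θ_fl]; exact Int.floor_mono (show (a.l:ℚ) ≤ b.l from Om_le_l h.le)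
    refine lt_of_le_of_ne (int_le ha h1) (fun e => ?_)
    rw [θ_ni μ hb] at e
    exact μ.m_ni _ _ hb (e ▸ ha)
  · have h0 : a.l < b.l := by
      refine lt_of_le_of_ne (Om_le_l h.le) (fun e => ha (e ▸ hb))
    rw [θ_int μ hb, Om_lt]
    left
    by_contra hc
    have h1 := Int.floor_mono (show (b.l:ℚ) ≤ (θ μ a).l from not_lt.mp hc)
    have h2 : flO (θ μ a) = flO a := θ_fl μ a
    unfold flO at h2
    rw [h2] at h1
    have := int_le hb h1
    exact absurd (L_lt.mp h0) (not_lt.mpr this)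
  · rw [θ_ni μ ha, θ_ni μ hb, Om_lt]
    rw [Om_lt] at h
    rcases h with h | ⟨h, i, h1, h2⟩
    · left; exact μ.m_lt _ _ _ _ ha hb (Or.inl h)
    · cases i with
      | zero => left; exact μ.m_lt _ _ _ _ ha hb (Or.inr ⟨h, h2⟩)
      | succ i =>
        right
        refine ⟨?_, i, fun j hj => h1 (j+1) (by omega), h2⟩
        change μ.m a.l (a.z 0) = μ.m b.l (b.z 0)
        rw [h, h1 0 (by omega)]

lemma tL_int {ℓ : L} : isInt (tL ℓ) ↔ isInt ℓ := by
  constructor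
  · rintro ⟨v, h⟩
    refine ⟨v - 1, Subtype.ext ?_⟩
    have := congrArg (Subtype.val) h
    rw [tL_coe] at this
    change (ℓ:ℚ) + 1 = ((v:ℤ):ℚ) at this
    change (ℓ:ℚ) = ((v-1:ℤ):ℚ)
    push_cast; linarith
  · rintro ⟨v, rfl⟩
    refine ⟨v + 1, Subtype.ext ?_⟩
    rw [tL_coe]
    change ((v:ℤ):ℚ) + 1 = ((v+1:ℤ):ℚ)
    push_cast; ring

lemma θ_t : Commute (θ μ) (ι X tL) := by
  apply Equiv.ext
  intro a
  change θ μ (ι X tL a) = ι X tL (θ μ a)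
  by_cases h : isInt a.l
  · rw [θ_int μ h, θ_int]
    exact tL_int.mpr h
  · rw [θ_ni μ h, θ_ni]
    · change (⟨μ.m (tL a.l) (a.z 0), _⟩ : Om X) = ⟨tL (μ.m a.l (a.z 0)), _⟩
      rw [μ.m_t _ _ h]
      rfl
    · exact fun h' => h (tL_int.mp h')

end order

/-- Order preserving action. -/
class Act (G X : Type) [Group G] [LinearOrder X] [OrderBot X] extends MulAction G X where
  mono : ∀ g : G, StrictMono (fun x : X => g • x)

section act
variable {G X : Type} [Group G] [LinearOrder X] [OrderBot X] [Act G X]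

lemma act_bot (g : G) : g • (⊥ : X) = ⊥ := by
  apply le_antisymm _ bot_le
  have h : (⊥:X) ≤ g⁻¹ • (⊥:X) := bot_le
  have := (Act.mono (X := X) g).monotone h
  simpa using this

lemma act_eq_bot {g : G} {x : X} : g • x = ⊥ ↔ x = ⊥ := by
  constructor
  · intro h
    have := congrArg (fun y => g⁻¹ • y) h
    simpa [act_bot] using this
  · rintro rfl; exact act_bot g

open Classical in
/-- Action on sequences. -/
noncomputable def sact (g : G) (z : ℕ → X) : ℕ → X :=
  fun i => if ∀ j < i, z j = ⊥ then g • z i else z i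

lemma sact_bot (g : G) (z : ℕ → X) (i : ℕ) : sact g z i = ⊥ ↔ z i = ⊥ := by
  unfold sact; split_ifs
  · exact act_eq_bot
  · rfl

lemma sact_one (z : ℕ → X) : sact (1:G) z = z := by
  funext i; simp [sact]

lemma sact_mul (g h : G) (z : ℕ → X) : sact (g * h) z = sact g (sact h z) := by
  classical
  funext i
  by_cases hz : ∀ j < i, z j = ⊥
  · have h2 : ∀ j < i, sact h z j = ⊥ := fun j hj => (sact_bot h z j).mpr (hz j hj)
    rw [sact, if_pos hz, sact, if_pos h2, sact, if_pos hz, mul_smul]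
  · have h2 : ¬ ∀ j < i, sact h z j = ⊥ := fun h' => hz fun j hj => (sact_bot h z j).mp (h' j hj)
    rw [sact, if_neg hz, sact, if_neg h2, sact, if_neg hz]

lemma sact_lt (g : G) {z w : ℕ → X} {i : ℕ} (h : ∀ j < i, z j = w j) (h' : z i < w i) :
    (∀ j < i, sact g z j = sact g w j) ∧ sact g z i < sact g w i := by
  classical
  have key : ∀ j ≤ i, ((∀ k < j, z k = ⊥) ↔ ∀ k < j, w k = ⊥) := by
    intro j hj
    constructor
    · intro hh k hk; rw [← h k (by omega)]; exact hh k hk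
    · intro hh k hk; rw [h k (by omega)]; exact hh k hk
  constructor
  · intro j hj
    unfold sact
    simp only [key j hj.le, h j hj]
  · unfold sact
    simp only [key i le_rfl]
    split_ifs
    · exact Act.mono g h'
    · exact h'

/-- Labelled action. -/
noncomputable def lab (X : Type) [LinearOrder X] [OrderBot X] [Act G X] :
    (L → G) →* Perm (Om X) where
  toFun F :=
    { toFun := fun a => ⟨a.l, sact (F a.l) a.z⟩
      invFun := fun a => ⟨a.l, sact (F a.l)⁻¹ a.z⟩
      left_inv := fun a => by simp [← sact_mul, sact_one]
      right_inv := fun a => by simp [← sact_mul, sact_one] }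
  map_one' := by
    apply Equiv.ext; intro a
    simp [sact_one]
  map_mul' F F' := by
    apply Equiv.ext; intro a
    simp [sact_mul]

lemma lab_apply (F : L → G) (a : Om X) : lab X F a = ⟨a.l, sact (F a.l) a.z⟩ := rfl

lemma lab_mono (F : L → G) : StrictMono (lab X F) := by
  intro a b h
  rw [Om_lt] at h ⊢
  rcases h with h | ⟨h, i, h1, h2⟩
  · exact Or.inl h
  · refine Or.inr ⟨h, i, ?_⟩
    rw [lab_apply, lab_apply, h]
    exact sact_lt _ h1 h2

lemma lab_conj (e : Perm L) (F : L → G) :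
    ι X e * lab X F * (ι X e)⁻¹ = lab X (fun ℓ => F (e⁻¹ ℓ)) := by
  apply Equiv.ext
  intro a
  rw [← map_inv]
  change (⟨e (e⁻¹ a.l), sact (F (e⁻¹ a.l)) a.z⟩ : Om X) = ⟨a.l, sact (F (e⁻¹ a.l)) a.z⟩
  simp

/-- The data on the big line. -/
noncomputable def DO (μ : Mu X) (f0 : L → G) (hf0 : ∀ ℓ, f0 ((tL ^ (4:ℤ)) ℓ) = f0 ℓ) :
    Dat (Om X) where
  fl := flO
  t := ι X tL
  β := ι X βL
  fl_mono := fun a b h => Int.floor_mono (show (a.l:ℚ) ≤ b.l from Om_le_l h)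
  fl_t := fun a => DL.fl_t a.l
  t_mono := ι_mono DL.t_mono
  β_mono := ι_mono DL.β_mono
  β_supp := fun a h => Om.ext (DL.β_supp a.l h) rfl
  ident := by
    have := congrArg (ι X) identL
    simpa only [map_mul, map_zpow] using this
  Φ := {1, (θ μ)⁻¹, lab X f0}
  fin := by simp
  one_mem := by simp
  Φ_mono := by
    rintro φ (rfl | rfl | rfl)
    · exact fun a b h => h
    · exact Dat.inv_mono (θ_mono μ)
    · exact lab_mono f0
  Φ_fl := by
    rintro φ (rfl | rfl | rfl) x
    · rfl
    · exact θi_fl μ x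
    · rfl
  Φ_comm := by
    rintro φ (rfl | rfl | rfl)
    · exact Commute.one_left _
    · exact ((θ_t μ).inv_left).zpow_right 4
    · rw [← map_zpow]
      apply Equiv.ext
      intro a
      change (⟨(tL ^ (4:ℤ)) a.l, sact (f0 ((tL ^ (4:ℤ)) a.l)) a.z⟩ : Om X) =
        ⟨(tL ^ (4:ℤ)) a.l, sact (f0 a.l) a.z⟩
      rw [hf0]

variable (μ : Mu X) (f0 : L → G) (hf0 : ∀ ℓ, f0 ((tL ^ (4:ℤ)) ℓ) = f0 ℓ)

lemma DO_bj (j : ℤ) : (DO μ f0 hf0).bj j = ι X (DL.bj j) := by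
  unfold Dat.bj
  simp only [map_mul, map_zpow]
  rfl

lemma DO_bb (c : ℤ) (A : Set ℤ) : (DO μ f0 hf0).bb c A = ι X (DL.bb c A) := by
  classical
  apply Equiv.ext
  intro a
  have b1 := start_le c 0 (M := 4) (by norm_num) (flO a)
  have b2 := lt_start c 0 (M := 4) (by norm_num) (flO a)
  have b3 := start_dvd c 0 4 (flO a)
  set n := start c 0 4 (flO a) with hn
  have e1 := Dat.bb_apply (DO μ f0 hf0) (x := a) (A := A) b3 (show n ≤ flO a by linarith)
    (show flO a < n + 4 by linarith)
  have e2 := Dat.bb_apply DL (x := a.l) (A := A) b3 (show n ≤ flO a by linarith)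
    (show flO a < n + 4 by linarith)
  rw [e1, ι_apply, e2, DO_bj]
  split_ifs <;> rfl

end act

end FE

namespace FE
open Equiv

section co
variable {G X : Type} [Group G] [LinearOrder X] [OrderBot X] [Act G X]
variable (μ : Mu X) (f0 : L → G) (hf0 : ∀ ℓ, f0 ((tL ^ (4:ℤ)) ℓ) = f0 ℓ)

/-- Base point over an integer. -/
def oo (X : Type) [LinearOrder X] [OrderBot X] (m : ℤ) : Om X := ⟨iL m, fun _ => ⊥⟩

lemma oo_le {m : ℤ} {a : Om X} (h : iL m ≤ a.l) : oo X m ≤ a := by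
  by_contra hc
  rcases Om_lt.mp (not_le.mp hc) with h' | ⟨_, i, _, h'⟩
  · exact absurd h' (not_lt.mpr h)
  · exact not_lt_bot h'

lemma lt_oo {m : ℤ} {a : Om X} : a < oo X m ↔ a.l < iL m := by
  constructor
  · intro h
    by_contra hc
    exact absurd h (not_lt.mpr (oo_le (not_lt.mp hc)))
  · intro h; exact Om_lt.mpr (Or.inl h)

lemma Bs_Loc' {φ : Perm (Om X)} (hφ : φ ∈ (DO μ f0 hf0).Φ) {b : Perm L} (hb : b ∈ Bs) :
    φ * ι X b * φ⁻¹ ∈ (DO μ f0 hf0).Loc := by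
  induction hb using Subgroup.closure_induction with
  | mem x hx =>
    obtain ⟨j, rfl⟩ := hx
    exact Subgroup.subset_closure ⟨φ, hφ, j, by rw [DO_bj]⟩
  | one => rw [map_one, mul_one, mul_inv_cancel]; exact one_mem _
  | mul x y _ _ hx hy =>
    have : φ * ι X (x * y) * φ⁻¹ = (φ * ι X x * φ⁻¹) * (φ * ι X y * φ⁻¹) := by
      rw [map_mul]; group
    rw [this]; exact mul_mem hx hy
  | inv x _ hx =>
    have : φ * ι X x⁻¹ * φ⁻¹ = (φ * ι X x * φ⁻¹)⁻¹ := by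
      rw [map_inv]; group
    rw [this]; exact inv_mem hx

lemma Bs_Loc {b : Perm L} (hb : b ∈ Bs) : ι X b ∈ (DO μ f0 hf0).Loc := by
  have := Bs_Loc' μ f0 hf0 (DO μ f0 hf0).one_mem hb
  simpa using this

lemma Bs_Locθ {b : Perm L} (hb : b ∈ Bs) : (θ μ)⁻¹ * ι X b * θ μ ∈ (DO μ f0 hf0).Loc := by
  have := Bs_Loc' μ f0 hf0 (φ := (θ μ)⁻¹) (Or.inr (Or.inl rfl)) hb
  simpa using this

lemma Loc_mono {s : Perm (Om X)} (hs : s ∈ (DO μ f0 hf0).Loc) : StrictMono s := by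
  induction hs using Subgroup.closure_induction with
  | mem x hx =>
    obtain ⟨φ, hφ, j, rfl⟩ := hx
    have h1 := (DO μ f0 hf0).Φ_mono φ hφ
    rw [DO_bj]
    exact (h1.comp (ι_mono (bj_mono j))).comp (Dat.inv_mono h1)
  | one => exact fun a b h => h
  | mul x y _ _ hx hy => exact hx.comp hy
  | inv x _ hx => exact Dat.inv_mono hx

/-- One half. -/
def hf : L := ⟨1/2, Dy_half Dy_one⟩

lemma hf_ni : ¬ isInt hf := by
  rintro ⟨v, h⟩
  have := congrArg (Subtype.val) h
  change (1/2 : ℚ) = ((v:ℤ):ℚ) at this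
  have h2 : ((2 * v : ℤ) : ℚ) = ((1:ℤ):ℚ) := by push_cast; linarith
  have h3 : 2 * v = 1 := by exact_mod_cast h2
  omega

lemma sep_i (i : ℕ) : ∀ c d : Om X, c.l = d.l → (∀ j < i, c.z j = d.z j) → c.z i < d.z i →
    ∃ s ∈ (DO μ f0 hf0).Loc, ∃ m, s c < oo X m ∧ oo X m ≤ s d := by
  induction i with
  | zero =>
    intro c d hl _ hz
    obtain ⟨b, hb, h1⟩ := Bs_trans c.l hf
    obtain ⟨b', hb', h2⟩ := Bs_trans (μ.m hf (d.z 0)) (iL 0)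
    refine ⟨((θ μ)⁻¹ * ι X b' * θ μ) * ι X b, mul_mem (Bs_Locθ μ f0 hf0 hb')
      (Bs_Loc μ f0 hf0 hb), 0, ?_⟩
    have e0 : (θ μ)⁻¹ (oo X 0) = oo X 0 := θi_int μ ⟨0, rfl⟩
    have e1 : ι X b c = ⟨hf, c.z⟩ := by rw [ι_apply, h1]
    have e2 : ι X b d = ⟨hf, d.z⟩ := by rw [ι_apply, ← hl, h1]
    have im := Dat.inv_mono (θ_mono μ)
    simp only [Perm.mul_apply, e1, e2]
    rw [← e0]
    constructor
    · apply im
      rw [lt_oo, θ_ni μ hf_ni, ι_apply]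
      change b' (μ.m hf (c.z 0)) < iL 0
      rw [← h2]
      exact Bs_mono hb' (μ.m_lt _ _ _ _ hf_ni hf_ni (Or.inr ⟨rfl, hz⟩))
    · apply im.monotone
      apply oo_le
      rw [θ_ni μ hf_ni, ι_apply]
      exact h2.ge
  | succ i ih =>
    intro c d hl hj hz
    obtain ⟨b, hb, h1⟩ := Bs_trans c.l hf
    obtain ⟨b', hb', h2⟩ := Bs_trans (μ.m hf (d.z 0)) (iL 0)
    have h2' : b' (μ.m hf (c.z 0)) = iL 0 := by rw [hj 0 (by omega), h2]
    obtain ⟨s, hs, m, h⟩ := ih ⟨iL 0, fun i => c.z (i+1)⟩ ⟨iL 0, fun i => d.z (i+1)⟩ rfl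
      (fun j hj' => hj (j+1) (by omega)) hz
    refine ⟨s * (((θ μ)⁻¹ * ι X b' * θ μ) * ι X b), mul_mem hs (mul_mem (Bs_Locθ μ f0 hf0 hb')
      (Bs_Loc μ f0 hf0 hb)), m, ?_⟩
    have e1 : ι X b c = ⟨hf, c.z⟩ := by rw [ι_apply, h1]
    have e2 : ι X b d = ⟨hf, d.z⟩ := by rw [ι_apply, ← hl, h1]
    simp only [Perm.mul_apply, e1, e2]
    rw [θ_ni μ (a := ⟨hf, c.z⟩) hf_ni, ι_apply, θ_ni μ (a := ⟨hf, d.z⟩) hf_ni, ι_apply]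
    simp only [h2, h2']
    rw [θi_int μ (a := ⟨iL 0, fun i => c.z (i+1)⟩) ⟨0, rfl⟩,
      θi_int μ (a := ⟨iL 0, fun i => d.z (i+1)⟩) ⟨0, rfl⟩]
    exact h

lemma sep {c d : Om X} (h : c < d) :
    ∃ s ∈ (DO μ f0 hf0).Loc, ∃ m, s c < oo X m ∧ oo X m ≤ s d := by
  rcases Om_lt.mp h with h | ⟨h, i, h1, h2⟩
  · obtain ⟨b, hb, e⟩ := Bs_trans d.l (iL 0)
    refine ⟨ι X b, Bs_Loc μ f0 hf0 hb, 0, ?_, ?_⟩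
    · rw [lt_oo, ι_apply, ← e]; exact Bs_mono hb h
    · apply oo_le; exact e.ge
  · exact sep_i μ f0 hf0 i c d h h1 h2

lemma DO_CO : ∀ x d, x < d → ∃ s ∈ (DO μ f0 hf0).Loc, ∀ y, 0 ≤ (DO μ f0 hf0).fl y →
    (DO μ f0 hf0).fl y < 4 → x ≤ s y ∧ s y < d := by
  intro c d h
  obtain ⟨s, hs, m, h1, h2⟩ := sep μ f0 hf0 h
  obtain ⟨b, hb, e⟩ := Bs_trans (iL m) (iL 4)
  have eo : ι X b (oo X m) = oo X 4 := Om.ext e rfl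
  have bm := ι_mono (X := X) (Bs_mono hb)
  have h3 : (ι X b * s) c < oo X 4 := by rw [← eo]; exact bm h1
  have h4 : oo X 4 ≤ (ι X b * s) d := by rw [← eo]; exact bm.monotone h2
  have hs' : ι X b * s ∈ (DO μ f0 hf0).Loc := mul_mem (Bs_Loc μ f0 hf0 hb) hs
  generalize ι X b * s = s' at h3 h4 hs'
  have h5 : (((s' c).l : L) : ℚ) < 4 := by
    have := lt_oo.mp h3
    have h' : (((s' c).l : L) : ℚ) < ((4:ℤ):ℚ) := this
    exact_mod_cast h'
  obtain ⟨k, hk⟩ := exists_pow_lt_of_lt_one (show (0:ℚ) < 4 - (s' c).l by linarith)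
    (show (1/2:ℚ) < 1 by norm_num)
  obtain ⟨p, hp, p4, p0⟩ := push4 k
  have pm := Bs_mono hp
  have hinv : StrictMono (s'⁻¹ : Perm (Om X)) := Dat.inv_mono (Loc_mono μ f0 hf0 hs')
  refine ⟨s'⁻¹ * ι X p, mul_mem (inv_mem hs') (Bs_Loc μ f0 hf0 hp), fun y y0 y4 => ?_⟩
  have a0 : iL 0 ≤ y.l := by
    change ((0:ℤ):ℚ) ≤ _
    exact Int.le_floor.mp y0
  have a4 : y.l < iL 4 := by
    change _ < ((4:ℤ):ℚ)
    exact Int.floor_lt.mp y4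
  have h6 : s' c < ι X p y := by
    rw [Om_lt]; left
    refine lt_of_lt_of_le ?_ (pm.monotone a0)
    change ((s' c).l : ℚ) < ((p (iL 0) : L) : ℚ)
    rw [p0, one_div, ← inv_pow, ← one_div]
    linarith
  have h7 : ι X p y < s' d := by
    refine lt_of_lt_of_le ?_ h4
    rw [lt_oo, ← p4]
    exact pm a4
  have i1 := hinv h6
  have i2 := hinv h7
  rw [show s'⁻¹ (s' c) = c by simp] at i1
  rw [show s'⁻¹ (s' d) = d by simp] at i2
  exact ⟨i1.le, i2⟩

lemma DO_nomax : ∀ x, ∃ d, x < d ∧ (DO μ f0 hf0).fl d = (DO μ f0 hf0).fl x := by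
  intro x
  have h1 := Int.floor_le (x.l:ℚ)
  have h2 := Int.lt_floor_add_one (x.l:ℚ)
  have hd : ((x.l:ℚ) + (⌊(x.l:ℚ)⌋ + 1)) / 2 ∈ Dy :=
    Dy_half (add_mem x.l.2 (add_mem (Dy_int _) Dy_one))
  refine ⟨⟨⟨_, hd⟩, x.z⟩, Om_lt.mpr (Or.inl ?_), ?_⟩
  · rw [L_lt]
    change (x.l:ℚ) < ((x.l:ℚ) + (⌊(x.l:ℚ)⌋ + 1)) / 2
    linarith
  · change ⌊((x.l:ℚ) + (⌊(x.l:ℚ)⌋ + 1)) / 2⌋ = ⌊(x.l:ℚ)⌋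
    rw [Int.floor_eq_iff]
    constructor <;> linarith

lemma DO_β : ∃ x, (DO μ f0 hf0).β x ≠ x := by
  refine ⟨oo X 1, fun h => ?_⟩
  have h1 : βL (iL 1) = iL 1 := congrArg Om.l h
  have h2 := congrArg (Subtype.val) h1
  change bq ((1:ℤ):ℚ) = ((1:ℤ):ℚ) at h2
  push_cast at h2
  rw [bq3 (by norm_num) (by norm_num)] at h2
  norm_num at h2

lemma DO_simple : IsSimpleGroup (DO μ f0 hf0).H :=
  (DO μ f0 hf0).H_simple (DO_CO μ f0 hf0) (DO_nomax μ f0 hf0) (DO_β μ f0 hf0)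

end co
end FE

namespace FE
open Equiv

/-- The periodic bumps on the line. -/
noncomputable def bL (j : ℤ) : Perm L := DL.bb j Set.univ

lemma bL_mono (j : ℤ) : StrictMono (bL j) := DL.bb_mono _ _

lemma bL_apply {j a : ℤ} (hj : 1 ≤ j) (hj' : j ≤ 3) {x : L} (h1 : 4 * (a:ℚ) + 1 ≤ x)
    (h2 : (x:ℚ) < 4 * a + 5) : ((bL j x : L) : ℚ) = bq (x - (4 * a + j)) + (4 * a + j) := by
  classical
  have f1 : 4 * a + 1 ≤ DL.fl x := by
    change _ ≤ ⌊(x:ℚ)⌋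
    rw [Int.le_floor]; push_cast; linarith
  have f2 : DL.fl x < 4 * a + 5 := by
    change ⌊(x:ℚ)⌋ < _
    rw [Int.floor_lt]; push_cast; linarith
  have j1 : (1:ℚ) ≤ j := by exact_mod_cast hj
  have j3 : (j:ℚ) ≤ 3 := by exact_mod_cast hj'
  by_cases h : 4 * a + j ≤ DL.fl x
  · have := Dat.bb_apply DL (c := j) (n := 4 * a + j) (x := x) (A := Set.univ) ⟨a, by ring⟩ h
      (by linarith)
    rw [bL, this, if_pos (Set.mem_univ _), DL_bj]
    push_cast; ring_nf
  · push Not at h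
    have := Dat.bb_apply DL (c := j) (n := 4 * a + j - 4) (x := x) (A := Set.univ)
      ⟨a - 1, by ring⟩ (by linarith) (by linarith)
    rw [bL, this, if_pos (Set.mem_univ _), DL_bj]
    have h' : (x:ℚ) < 4 * a + j := by
      have h' : ⌊(x:ℚ)⌋ < 4 * a + j := h
      rw [Int.floor_lt] at h'; push_cast at h'; exact h'
    push_cast
    rw [bq5 (by linarith), bq1 (by linarith)]; ring

lemma tile_ex (x : L) : ∃ a : ℤ, 4 * (a:ℚ) + 1 ≤ x ∧ (x:ℚ) < 4 * a + 5 := by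
  refine ⟨⌊((x:ℚ) - 1) / 4⌋, ?_, ?_⟩
  · have := Int.floor_le (((x:ℚ) - 1) / 4); linarith
  · have := Int.lt_floor_add_one (((x:ℚ) - 1) / 4); linarith

/-- Points of the line in a tile. -/
def pt (a : ℤ) (s : Dy) : L := ⟨4 * a + s, add_mem (by simpa using Dy_int (4 * a)) s.2⟩

lemma pt_coe (a : ℤ) (s : Dy) : ((pt a s : L) : ℚ) = 4 * a + s := rfl

/-- Halves. -/
def hfs (n : ℤ) : Dy := ⟨(n:ℚ) / 2, Dy_half (Dy_int n)⟩

lemma bL_pt {j : ℤ} (hj : 1 ≤ j) (hj' : j ≤ 3) (a : ℤ) (s s' : ℤ) (h1 : 2 ≤ s) (h2 : s < 10)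
    (h : bq ((s:ℚ) / 2 - j) + j = (s':ℚ) / 2) : bL j (pt a (hfs s)) = pt a (hfs s') := by
  have h1' : (2:ℚ) ≤ s := by exact_mod_cast h1
  have h2' : (s:ℚ) < 10 := by exact_mod_cast h2
  apply Subtype.ext
  have e : ((pt a (hfs s) : L) : ℚ) = 4 * a + (s:ℚ) / 2 := rfl
  rw [bL_apply hj hj' (a := a) (by rw [e]; linarith) (by rw [e]; linarith), e]
  change _ = 4 * (a:ℚ) + (s':ℚ) / 2
  rw [← h, show 4 * (a:ℚ) + s / 2 - (4 * a + j) = s / 2 - j by ring]; ring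

/-- The set of points with phase in an interval. -/
def Wd (u v : ℚ) : Set L := {x | ∃ a : ℤ, 4 * (a:ℚ) + u ≤ x ∧ (x:ℚ) < 4 * a + v}

lemma Wd_in {u v : ℚ} (hu : 1 ≤ u) (hv : v ≤ 5) {x : L} (h : x ∈ Wd u v) {a : ℤ}
    (h1 : 4 * (a:ℚ) + 1 ≤ x) (h2 : (x:ℚ) < 4 * a + 5) :
    4 * (a:ℚ) + u ≤ x ∧ (x:ℚ) < 4 * a + v := by
  obtain ⟨a', h3, h4⟩ := h
  have e1 : (a:ℚ) < a' + 1 := by linarith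
  have e2 : (a':ℚ) < a + 1 := by linarith
  have e3 : a < a' + 1 := by exact_mod_cast e1
  have e4 : a' < a + 1 := by exact_mod_cast e2
  have : a' = a := by omega
  subst this
  exact ⟨h3, h4⟩

lemma bL_t {j : ℤ} (hj : 1 ≤ j) (hj' : j ≤ 3) : Commute (bL j) (tL ^ (4:ℤ)) := by
  apply Equiv.ext
  intro x
  obtain ⟨a, h1, h2⟩ := tile_ex x
  apply Subtype.ext
  change ((bL j ((tL ^ (4:ℤ)) x) : L) : ℚ) = (((tL ^ (4:ℤ)) (bL j x) : L) : ℚ)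
  have e := tL_zpow 4 x
  rw [tL_zpow, bL_apply hj hj' h1 h2, bL_apply hj hj' (a := a + 1), e]
  · push_cast
    rw [show (x:ℚ) + 4 - (4 * (a+1) + j) = x - (4 * a + j) by ring]; ring
  · rw [e]; push_cast; linarith
  · rw [e]; push_cast; linarith

lemma Wd_t {u v : ℚ} (x : L) : (tL ^ (4:ℤ)) x ∈ Wd u v ↔ x ∈ Wd u v := by
  have e := tL_zpow 4 x
  push_cast at e
  constructor
  · rintro ⟨a, h1, h2⟩
    rw [e] at h1 h2
    exact ⟨a - 1, by push_cast; linarith, by push_cast; linarith⟩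
  · rintro ⟨a, h1, h2⟩
    refine ⟨a + 1, ?_, ?_⟩ <;> rw [e] <;> push_cast <;> linarith

lemma r_Wm {x : L} (h : x ∈ Wd (5/2) 3) : bL 2 x ∈ Wd 3 (7/2) := by
  obtain ⟨a, h1, h2⟩ := h
  refine ⟨a, ?_⟩
  rw [bL_apply (a := a) (by norm_num) (by norm_num) (by linarith) (by linarith)]
  push_cast
  rw [bq3 (by linarith) (by linarith)]
  constructor <;> linarith

lemma r_S {x : L} (h : x ∈ Wd 3 4) : bL 2 x ∈ Wd (7/2) 4 := by
  obtain ⟨a, h1, h2⟩ := h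
  refine ⟨a, ?_⟩
  rw [bL_apply (a := a) (by norm_num) (by norm_num) (by linarith) (by linarith)]
  push_cast
  rw [bq4 (by linarith) (by linarith)]
  constructor <;> linarith

lemma Wd_mono {u v u' v' : ℚ} (h : u' ≤ u) (h' : v ≤ v') : Wd u v ⊆ Wd u' v' := by
  rintro x ⟨a, h1, h2⟩
  exact ⟨a, by linarith, by linarith⟩

lemma r_pow {x : L} (h : x ∈ Wd 3 4) (n : ℕ) : ((bL 2) ^ (n+1)) x ∈ Wd (7/2) 4 := by
  induction n with
  | zero => rw [zero_add, pow_one]; exact r_S h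
  | succ n ih =>
    rw [pow_succ' _ (n+1), Perm.mul_apply]
    exact r_S (Wd_mono (by norm_num) le_rfl ih)

lemma r_wand {k k' : ℤ} {x : L} (h : ((bL 2) ^ (-k)) x ∈ Wd 3 (7/2))
    (h' : ((bL 2) ^ (-k')) x ∈ Wd 3 (7/2)) : k = k' := by
  have key : ∀ k k' : ℤ, k < k' → ((bL 2) ^ (-k)) x ∈ Wd 3 (7/2) →
      ((bL 2) ^ (-k')) x ∈ Wd 3 (7/2) → False := by
    intro k k' hk h h'
    obtain ⟨n, hn⟩ : ∃ n : ℕ, k' - k = ((n + 1 : ℕ) : ℤ) := ⟨(k' - k - 1).toNat, by omega⟩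
    have h3 := r_pow (Wd_mono le_rfl (by norm_num) h') n
    rw [← zpow_natCast, ← hn, ← Perm.mul_apply, ← zpow_add,
      show k' - k + -k' = -k by ring] at h3
    obtain ⟨a, h1, h2⟩ := h3
    have := Wd_in (by norm_num) (by norm_num) h (a := a) (by linarith) (by linarith)
    linarith [this.2]
  rcases lt_trichotomy k k' with hk | hk | hk
  · exact (key _ _ hk h h').elim
  · exact hk
  · exact (key _ _ hk h' h).elim

/-- The conjugator. -/
noncomputable def cL : Perm L := bL 1 * (bL 3)⁻¹

/-- The second map. -/
noncomputable def qL : Perm L := cL * bL 2 * cL⁻¹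

lemma mul_mono {Ω : Type} [LinearOrder Ω] {a b : Perm Ω} (ha : StrictMono a) (hb : StrictMono b) :
    StrictMono (a * b : Perm Ω) := fun _ _ h => ha (hb h)

lemma cL_mono : StrictMono cL := by
  unfold cL
  exact mul_mono (bL_mono 1) (Dat.inv_mono (bL_mono 3))

lemma qL_mono : StrictMono qL := by
  unfold qL
  exact mul_mono (mul_mono cL_mono (bL_mono 2)) (Dat.inv_mono cL_mono)

lemma cL_pt {a s s' s'' : ℤ} (h1 : 2 ≤ s') (h2 : s' < 10)
    (h : bq ((s':ℚ) / 2 - 3) + 3 = (s:ℚ) / 2)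
    (h' : bq ((s':ℚ) / 2 - 1) + 1 = (s'':ℚ) / 2) : cL (pt a (hfs s)) = pt a (hfs s'') := by
  have e3 := bL_pt (j := 3) (by norm_num) (by norm_num) a s' s h1 h2 (by exact_mod_cast h)
  have e1 := bL_pt (j := 1) (by norm_num) (by norm_num) a s' s'' h1 h2 (by exact_mod_cast h')
  rw [cL, Perm.mul_apply, ← e3, ← e1]
  simp

lemma cL2 (a : ℤ) : cL (pt a (hfs 2)) = pt a (hfs 2) :=
  cL_pt (s' := 2) (by norm_num) (by norm_num) (by rw [bq1 (by norm_num)]; norm_num)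
    (by rw [bq1 (by norm_num)]; norm_num)
lemma cL4 (a : ℤ) : cL (pt a (hfs 4)) = pt a (hfs 5) :=
  cL_pt (s' := 4) (by norm_num) (by norm_num) (by rw [bq1 (by norm_num)]; norm_num)
    (by rw [bq3 (by norm_num) (by norm_num)]; norm_num)
lemma cL6 (a : ℤ) : cL (pt a (hfs 6)) = pt a (hfs 6) :=
  cL_pt (s' := 6) (by norm_num) (by norm_num) (by rw [bq1 (by norm_num)]; norm_num)
    (by rw [bq5 (by norm_num)]; norm_num)
lemma cL8 (a : ℤ) : cL (pt a (hfs 8)) = pt a (hfs 7) :=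
  cL_pt (s' := 7) (by norm_num) (by norm_num) (by rw [bq2 (by norm_num) (by norm_num)]; norm_num)
    (by rw [bq5 (by norm_num)]; norm_num)
lemma pt_succ (a : ℤ) : pt a (hfs 10) = pt (a+1) (hfs 2) := by
  apply Subtype.ext
  change 4 * (a:ℚ) + ((10:ℤ):ℚ)/2 = 4 * ((a+1:ℤ):ℚ) + ((2:ℤ):ℚ)/2
  push_cast; ring
lemma cL10 (a : ℤ) : cL (pt a (hfs 10)) = pt a (hfs 10) := by
  rw [pt_succ, cL2]

lemma ci_le {x y z : L} (h : cL y = z) : z ≤ x ↔ y ≤ cL⁻¹ x := by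
  rw [← h]
  constructor
  · intro h'
    have := (Dat.inv_mono cL_mono).monotone h'
    simpa using this
  · intro h'
    have := cL_mono.monotone h'
    simpa using this

lemma ci_ge {x y z : L} (h : cL y = z) : x ≤ z ↔ cL⁻¹ x ≤ y := by
  rw [← h]
  constructor
  · intro h'
    have := (Dat.inv_mono cL_mono).monotone h'
    simpa using this
  · intro h'
    have := cL_mono.monotone h'
    simpa using this

lemma bL2_fix {x : L} {a : ℤ} (h : pt a (hfs 2) ≤ x ∧ x ≤ pt a (hfs 4) ∨
    pt a (hfs 8) ≤ x ∧ x ≤ pt a (hfs 10)) : bL 2 x = x := by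
  have e2 : ∀ n, ((pt a (hfs n) : L) : ℚ) = 4 * a + (n:ℚ) / 2 := fun n => rfl
  apply Subtype.ext
  rcases h with ⟨h1, h2⟩ | ⟨h1, h2⟩
  · replace h1 : _ ≤ (x:ℚ) := h1
    replace h2 : (x:ℚ) ≤ _ := h2
    rw [e2] at h1 h2
    push_cast at h1 h2
    rw [bL_apply (a := a) (by norm_num) (by norm_num) (by linarith) (by linarith)]
    push_cast
    rw [bq1 (by linarith)]; ring
  · replace h1 : _ ≤ (x:ℚ) := h1
    replace h2 : (x:ℚ) ≤ _ := h2
    rw [e2] at h1 h2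
    push_cast at h1 h2
    rcases h2.lt_or_eq with h2 | h2
    · rw [bL_apply (a := a) (by norm_num) (by norm_num) (by linarith) (by linarith)]
      push_cast
      rw [bq5 (by linarith)]; ring
    · rw [bL_apply (a := a+1) (by norm_num) (by norm_num) (by push_cast; linarith)
        (by push_cast; linarith)]
      push_cast
      rw [bq1 (by linarith)]; ring

lemma qL_fix {x : L} {a : ℤ} (h : pt a (hfs 2) ≤ x ∧ x ≤ pt a (hfs 5) ∨
    pt a (hfs 7) ≤ x ∧ x ≤ pt a (hfs 10)) : qL⁻¹ x = x := by
  have : bL 2 (cL⁻¹ x) = cL⁻¹ x := by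
    apply bL2_fix (a := a)
    rcases h with ⟨h1, h2⟩ | ⟨h1, h2⟩
    · exact Or.inl ⟨(ci_le (cL2 a)).mp h1, (ci_ge (cL4 a)).mp h2⟩
    · exact Or.inr ⟨(ci_le (cL8 a)).mp h1, (ci_ge (cL10 a)).mp h2⟩
  rw [Perm.inv_eq_iff_eq, qL, Perm.mul_apply, Perm.mul_apply, this]
  simp

lemma bL2_ge (x : L) : x ≤ bL 2 x := by
  obtain ⟨a, h1, h2⟩ := tile_ex x
  change (x:ℚ) ≤ ((bL 2 x : L) : ℚ)
  rw [bL_apply (a := a) (by norm_num) (by norm_num) h1 h2]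
  have : ∀ y : ℚ, y ≤ bq y := by
    intro y; unfold bq; split_ifs <;> linarith
  linarith [this (x - (4 * a + (2:ℤ)))]

lemma qi_le (x : L) : qL⁻¹ x ≤ x := by
  have : x ≤ qL x := by
    rw [qL, Perm.mul_apply, Perm.mul_apply]
    have := cL_mono.monotone (bL2_ge (cL⁻¹ x))
    rwa [show cL (cL⁻¹ x) = x by simp] at this
  have := (Dat.inv_mono qL_mono).monotone this
  rwa [show qL⁻¹ (qL x) = x by simp] at this

lemma q1 {x : L} (h0 : x ∉ Wd 3 (7/2)) (hm : x ∉ Wd (5/2) 3) : qL⁻¹ x = x := by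
  obtain ⟨a, h1, h2⟩ := tile_ex x
  have e2 : ∀ n, ((pt a (hfs n) : L) : ℚ) = 4 * a + (n:ℚ) / 2 := fun n => rfl
  apply qL_fix (a := a)
  change ((pt a (hfs 2) : L) : ℚ) ≤ x ∧ (x:ℚ) ≤ ((pt a (hfs 5) : L) : ℚ) ∨
    ((pt a (hfs 7) : L) : ℚ) ≤ x ∧ (x:ℚ) ≤ ((pt a (hfs 10) : L) : ℚ)
  simp only [e2]
  push_cast
  by_cases h : (x:ℚ) ≤ 4 * a + 5/2
  · left; constructor <;> linarith
  · right
    push Not at h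
    refine ⟨?_, by linarith⟩
    by_contra hc
    push Not at hc
    by_cases h3 : (x:ℚ) < 4 * a + 3
    · exact hm ⟨a, by linarith, h3⟩
    · exact h0 ⟨a, by linarith, by linarith⟩

lemma qi_ge {x : L} {a : ℤ} (h : 4 * (a:ℚ) + 5/2 ≤ x) : 4 * (a:ℚ) + 5/2 ≤ ((qL⁻¹ x : L) : ℚ) := by
  have e2 : ∀ n, ((pt a (hfs n) : L) : ℚ) = 4 * a + (n:ℚ) / 2 := fun n => rfl
  have h1 : qL⁻¹ (pt a (hfs 5)) = pt a (hfs 5) := by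
    apply qL_fix (a := a)
    left
    constructor
    · change ((pt a (hfs 2) : L) : ℚ) ≤ ((pt a (hfs 5) : L) : ℚ)
      rw [e2, e2]; push_cast; linarith
    · exact le_rfl
  have h2 : pt a (hfs 5) ≤ x := by
    change ((pt a (hfs 5) : L) : ℚ) ≤ x
    rw [e2]; push_cast; linarith
  have h3 := (Dat.inv_mono qL_mono).monotone h2
  rw [h1] at h3
  have h4 : ((pt a (hfs 5) : L) : ℚ) ≤ ((qL⁻¹ x : L) : ℚ) := h3
  rw [e2] at h4; push_cast at h4; exact h4

lemma q2 {x : L} (h : x ∈ Wd (5/2) 3) : qL⁻¹ x ∈ Wd (5/2) 3 := by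
  obtain ⟨a, h1, h2⟩ := h
  have : ((qL⁻¹ x : L) : ℚ) ≤ x := qi_le x
  exact ⟨a, qi_ge h1, by linarith⟩

lemma q3 {x : L} (h : x ∈ Wd 3 (7/2)) : qL⁻¹ x ∈ Wd 3 (7/2) ∨ qL⁻¹ x ∈ Wd (5/2) 3 := by
  obtain ⟨a, h1, h2⟩ := h
  have h3 : ((qL⁻¹ x : L) : ℚ) ≤ x := qi_le x
  have h4 := qi_ge (x := x) (a := a) (by linarith)
  by_cases hc : ((qL⁻¹ x : L) : ℚ) < 4 * a + 3
  · right; exact ⟨a, h4, hc⟩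
  · left; exact ⟨a, by linarith, by linarith⟩

lemma q40 : iL 3 ∈ Wd 3 (7/2) := by
  refine ⟨0, ?_, ?_⟩
  · change _ ≤ ((3:ℤ):ℚ); push_cast; norm_num
  · change ((3:ℤ):ℚ) < _; push_cast; norm_num

lemma q4 : qL⁻¹ (iL 3) ∉ Wd 3 (7/2) := by
  have e3 : iL 3 = pt 0 (hfs 6) := by
    apply Subtype.ext
    change ((3:ℤ):ℚ) = 4 * ((0:ℤ):ℚ) + ((6:ℤ):ℚ)/2
    norm_num
  have h1 : qL⁻¹ (iL 3) ≠ iL 3 := by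
    intro h
    rw [Perm.inv_eq_iff_eq, e3, qL, Perm.mul_apply, Perm.mul_apply,
      show cL⁻¹ (pt 0 (hfs 6)) = pt 0 (hfs 6) by rw [Perm.inv_eq_iff_eq, cL6],
      bL_pt (j := 2) (by norm_num) (by norm_num) 0 6 7 (by norm_num) (by norm_num)
        (by rw [bq3 (by norm_num) (by norm_num)]; norm_num)] at h
    have := cL.injective ((cL6 0).trans h)
    have h' := congrArg (Subtype.val) this
    change 4 * ((0:ℤ):ℚ) + ((6:ℤ):ℚ)/2 = 4 * ((0:ℤ):ℚ) + ((7:ℤ):ℚ)/2 at h'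
    norm_num at h'
  have h2 : ((qL⁻¹ (iL 3) : L) : ℚ) < 3 := by
    have : qL⁻¹ (iL 3) < iL 3 := lt_of_le_of_ne (qi_le _) h1
    have h' : ((qL⁻¹ (iL 3) : L) : ℚ) < ((3:ℤ):ℚ) := this
    exact_mod_cast h'
  have h3 : 4 * ((0:ℤ):ℚ) + 5/2 ≤ ((qL⁻¹ (iL 3) : L) : ℚ) := qi_ge (by
    change _ ≤ ((3:ℤ):ℚ); push_cast; norm_num)
  intro h
  have := Wd_in (by norm_num) (by norm_num) h (a := 0) (by push_cast at h3 ⊢; linarith)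
    (by push_cast; linarith)
  push_cast at this
  linarith [this.1]

end FE

namespace FE
open Equiv

section seq
variable {G X : Type} [Group G] [LinearOrder X] [OrderBot X] [Act G X]

/-- Prepend a list. -/
def app : List X → (ℕ → X) → (ℕ → X)
  | [], u => u
  | x :: p, u => cons x (app p u)

lemma app_append (p p' : List X) (u : ℕ → X) : app (p ++ p') u = app p (app p' u) := by
  induction p with
  | nil => rfl
  | cons x p ih => simp only [List.cons_append, app, ih]

lemma app_get (p : List X) (u : ℕ → X) (i : ℕ) : app p u (p.length + i) = u i := by
  induction p with
  | nil => simp [app]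
  | cons x p ih =>
    have : (x :: p).length + i = (p.length + i) + 1 := by simp; omega
    rw [this]; exact ih

lemma app_inj {p p' : List X} (h : p.length = p'.length) {u u' : ℕ → X}
    (e : app p u = app p' u') : u = u' := by
  funext i
  have := congrFun e (p.length + i)
  rwa [app_get, h, app_get] at this

lemma sact_cons_bot (g : G) (z : ℕ → X) : sact g (cons ⊥ z) = cons ⊥ (sact g z) := by
  classical
  funext i
  cases i with
  | zero =>
    have : sact g (cons ⊥ z) 0 = ⊥ := (sact_bot g _ 0).mpr rfl
    rw [this]; rfl
  | succ i =>
    have key : (∀ j < i + 1, (cons ⊥ z : ℕ → X) j = ⊥) ↔ ∀ j < i, z j = ⊥ := by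
      constructor
      · intro h j hj; exact h (j+1) (by omega)
      · intro h j hj
        cases j with
        | zero => rfl
        | succ j => exact h j (by omega)
    change (if ∀ j < i + 1, (cons ⊥ z : ℕ → X) j = ⊥ then g • z i else z i) =
      if ∀ j < i, z j = ⊥ then g • z i else z i
    simp only [key]

lemma sact_cons_ne (g : G) {x : X} (hx : x ≠ ⊥) (z : ℕ → X) :
    sact g (cons x z) = cons (g • x) z := by
  classical
  funext i
  cases i with
  | zero =>
    unfold sact
    rw [if_pos (by simp)]
    rfl
  | succ i =>
    unfold sact
    rw [if_neg]
    · rfl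
    · intro h; exact hx (h 0 (by omega))

lemma sact_rep (g : G) (k : ℕ) (u : ℕ → X) :
    sact g (app (List.replicate k ⊥) u) = app (List.replicate k ⊥) (sact g u) := by
  induction k with
  | zero => rfl
  | succ k ih => simp only [List.replicate_succ, app, sact_cons_bot, ih]

lemma dich (g : G) (p : List X) : (∀ u, sact g (app p u) = app p (sact g u)) ∨
    ∃ p' : List X, p'.length = p.length ∧ ∀ u, sact g (app p u) = app p' u := by
  induction p with
  | nil => left; intro u; rfl
  | cons x p ih =>
    by_cases hx : x = ⊥
    · subst hx
      rcases ih with ih | ⟨p', hl, ih⟩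
      · left; intro u; simp only [app, sact_cons_bot, ih]
      · right
        refine ⟨⊥ :: p', by simp [hl], fun u => ?_⟩
        simp only [app, sact_cons_bot, ih]
    · right
      refine ⟨(g • x) :: p, by simp, fun u => ?_⟩
      simp only [app, sact_cons_ne g hx]

lemma sact_faithful [FaithfulSMul G X] {g h : G} (e : ∀ u : ℕ → X, sact g u = sact h u) : g = h := by
  classical
  apply FaithfulSMul.eq_of_smul_eq_smul (α := X)
  intro x
  have := congrFun (e fun _ => x) 0
  unfold sact at this
  simpa using this

variable (G) in
/-- Tame maps. -/
def Tame (h : Perm (Om X)) : Prop := ∀ (ℓ : L) (p : List X), ∃ (k : ℕ) (ℓ' : L) (p' : List X) (g : G),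
  ∀ u, h ⟨ℓ, app (p ++ List.replicate k ⊥) u⟩ = ⟨ℓ', app p' (sact g u)⟩

lemma Tame.mul {h h' : Perm (Om X)} (H : Tame G h) (H' : Tame G h') : Tame G (h * h') := by
  intro ℓ p
  obtain ⟨k, ℓ', p', g, e⟩ := H' ℓ p
  obtain ⟨k', ℓ'', p'', g', e'⟩ := H ℓ' p'
  refine ⟨k + k', ℓ'', p'', g' * g, fun u => ?_⟩
  rw [Perm.mul_apply, List.replicate_add, ← List.append_assoc, app_append, e, sact_rep,
    ← app_append, e', sact_mul]

lemma Tame_ι (e : Perm L) : Tame G (ι X e) := by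
  intro ℓ p
  refine ⟨0, e ℓ, p, 1, fun u => ?_⟩
  rw [ι_apply, sact_one, List.replicate_zero, List.append_nil]

lemma Tame_lab (F : L → G) : Tame G (lab X F) := by
  intro ℓ p
  rcases dich (F ℓ) p with h | ⟨p', _, h⟩
  · refine ⟨0, ℓ, p, F ℓ, fun u => ?_⟩
    rw [lab_apply, List.replicate_zero, List.append_nil, h]
  · refine ⟨0, ℓ, p', 1, fun u => ?_⟩
    rw [lab_apply, List.replicate_zero, List.append_nil, h, sact_one]

lemma Tame_θ (μ : Mu X) : Tame G (θ μ) := by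
  intro ℓ p
  by_cases hℓ : isInt ℓ
  · refine ⟨0, ℓ, p, 1, fun u => ?_⟩
    rw [θ_int μ hℓ, List.replicate_zero, List.append_nil, sact_one]
  · cases p with
    | nil =>
      refine ⟨1, μ.m ℓ ⊥, [], 1, fun u => ?_⟩
      rw [θ_ni μ hℓ, sact_one]
      rfl
    | cons x p =>
      refine ⟨0, μ.m ℓ x, p, 1, fun u => ?_⟩
      rw [θ_ni μ hℓ, sact_one, List.replicate_zero, List.append_nil]
      rfl

lemma Tame_θi (μ : Mu X) : Tame G (θ μ)⁻¹ := by
  intro ℓ p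
  by_cases hℓ : isInt ℓ
  · refine ⟨0, ℓ, p, 1, fun u => ?_⟩
    rw [θi_int μ hℓ, List.replicate_zero, List.append_nil, sact_one]
  · refine ⟨0, μ.n ℓ, μ.k ℓ :: p, 1, fun u => ?_⟩
    rw [θi_ni μ hℓ, sact_one, List.replicate_zero, List.append_nil]
    rfl

variable (G X) in
/-- The group of tame maps. -/
def KT : Subgroup (Perm (Om X)) where
  carrier := {h | Tame G h ∧ Tame G h⁻¹}
  one_mem' := by
    have : Tame G (1 : Perm (Om X)) := by simpa using Tame_ι (G := G) (X := X) 1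
    exact ⟨this, by rw [inv_one]; exact this⟩
  mul_mem' := by
    rintro a b ⟨h1, h2⟩ ⟨h3, h4⟩
    exact ⟨h1.mul h3, by rw [mul_inv_rev]; exact h4.mul h2⟩
  inv_mem' := by
    rintro a ⟨h1, h2⟩
    exact ⟨h2, by rw [inv_inv]; exact h1⟩

variable (μ : Mu X) (f0 : L → G) (hf0 : ∀ ℓ, f0 ((tL ^ (4:ℤ)) ℓ) = f0 ℓ)

lemma KT_ι (e : Perm L) : ι X e ∈ KT G X := ⟨Tame_ι e, by rw [← map_inv]; exact Tame_ι _⟩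
lemma KT_lab (F : L → G) : lab X F ∈ KT G X := ⟨Tame_lab F, by rw [← map_inv]; exact Tame_lab _⟩
lemma KT_θ : θ μ ∈ KT G X := ⟨Tame_θ μ, Tame_θi μ⟩

lemma H_le_KT : (DO μ f0 hf0).H ≤ KT G X := by
  unfold Dat.H
  rw [Subgroup.closure_le]
  rintro _ ⟨φ, hφ, c, _, A, _, rfl⟩
  have hφ' : φ ∈ KT G X := by
    rcases hφ with rfl | rfl | rfl
    · exact one_mem _
    · exact inv_mem (KT_θ μ)
    · exact KT_lab f0
  rw [DO_bb]
  exact mul_mem (mul_mem hφ' (KT_ι _)) (inv_mem hφ')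

end seq

section emb
variable {G X : Type} [Group G] [LinearOrder X] [OrderBot X] [Act G X]

open Classical in
/-- The periodic labelling. -/
noncomputable def ff (g : ℤ → G) (ℓ : L) : G :=
  if h : ∃ k : ℤ, ((bL 2) ^ (-k)) ℓ ∈ Wd 3 (7/2) then g h.choose else 1

lemma ff_eq (g : ℤ → G) (k : ℤ) {y : L} (hy : y ∈ Wd 3 (7/2)) : ff g (((bL 2) ^ k) y) = g k := by
  have h1 : ((bL 2) ^ (-k)) (((bL 2) ^ k) y) ∈ Wd 3 (7/2) := by
    rw [← Perm.mul_apply, ← zpow_add, neg_add_cancel, zpow_zero]; exact hy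
  have h : ∃ k' : ℤ, ((bL 2) ^ (-k')) (((bL 2) ^ k) y) ∈ Wd 3 (7/2) := ⟨k, h1⟩
  rw [ff, dif_pos h, r_wand h.choose_spec h1]

lemma ff_eqm (g : ℤ → G) (k : ℤ) {y : L} (hy : y ∈ Wd (5/2) 3) :
    ff g (((bL 2) ^ k) y) = g (k - 1) := by
  rw [← ff_eq g (k-1) (r_Wm hy), ← Perm.mul_apply, zpow_sub_one, inv_mul_cancel_right]

lemma ff_t (g : ℤ → G) (ℓ : L) : ff g ((tL ^ (4:ℤ)) ℓ) = ff g ℓ := by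
  have key : ∀ k : ℤ, (((bL 2) ^ (-k)) ((tL ^ (4:ℤ)) ℓ) ∈ Wd 3 (7/2) ↔
      ((bL 2) ^ (-k)) ℓ ∈ Wd 3 (7/2)) := by
    intro k
    have h := (bL_t (j := 2) (by norm_num) (by norm_num)).zpow_left (-k)
    rw [← Perm.mul_apply, h.eq, Perm.mul_apply, Wd_t]
  by_cases h : ∃ k : ℤ, ((bL 2) ^ (-k)) ℓ ∈ Wd 3 (7/2)
  · have h' : ∃ k : ℤ, ((bL 2) ^ (-k)) ((tL ^ (4:ℤ)) ℓ) ∈ Wd 3 (7/2) :=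
      h.imp fun k hk => (key k).mpr hk
    rw [ff, ff, dif_pos h, dif_pos h', r_wand ((key _).mp h'.choose_spec) h.choose_spec]
  · have h' : ¬ ∃ k : ℤ, ((bL 2) ^ (-k)) ((tL ^ (4:ℤ)) ℓ) ∈ Wd 3 (7/2) :=
      fun hc => h (hc.imp fun k hk => (key k).mp hk)
    rw [ff, ff, dif_neg h, dif_neg h']

/-- The support of the embedded copy. -/
def A0 : Set L := {ℓ | ℓ ∈ Wd 3 (7/2) ∧ qL⁻¹ ℓ ∉ Wd 3 (7/2)}

lemma ff_quot (g : ℤ → G) (k : ℤ) (ℓ : L) [Decidable (ℓ ∈ A0)] :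
    ff g (((bL 2) ^ k) ℓ) * (ff g (((bL 2) ^ k) (qL⁻¹ ℓ)))⁻¹ =
      if ℓ ∈ A0 then g k * (g (k-1))⁻¹ else 1 := by
  by_cases h0 : ℓ ∈ Wd 3 (7/2)
  · by_cases h1 : qL⁻¹ ℓ ∈ Wd 3 (7/2)
    · rw [if_neg (fun h => h.2 h1), ff_eq g k h0, ff_eq g k h1, mul_inv_cancel]
    · rw [if_pos ⟨h0, h1⟩, ff_eq g k h0, ff_eqm g k ((q3 h0).resolve_left h1)]
  · rw [if_neg (fun h => h0 h.1)]
    by_cases hm : ℓ ∈ Wd (5/2) 3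
    · rw [ff_eqm g k hm, ff_eqm g k (q2 hm), mul_inv_cancel]
    · rw [q1 h0 hm, mul_inv_cancel]

open Classical in
/-- The embedding. -/
noncomputable def Ψ (X : Type) [LinearOrder X] [OrderBot X] [Act G X] : G →* Perm (Om X) :=
  (lab X).comp
    { toFun := fun g ℓ => if ℓ ∈ A0 then g else 1
      map_one' := by funext ℓ; simp
      map_mul' := by intro g h; funext ℓ; simp only [Pi.mul_apply]; split_ifs <;> simp }

open Classical in
lemma Ψ_eq (g : G) : Ψ X g = lab X (fun ℓ => if ℓ ∈ A0 then g else 1) := rfl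

variable (μ : Mu X) (gs : ℤ → G)

lemma Ψ_mem (k : ℤ) : Ψ X (gs k * (gs (k-1))⁻¹) ∈ (DO μ (ff gs) (ff_t gs)).H := by
  classical
  set D := DO μ (ff gs) (ff_t gs) with hD
  set f := lab X (ff gs) with hf
  have hb : ∀ j, ι X (bL j) ∈ D.H := by
    intro j
    have := D.univ_mem 1 D.one_mem j
    rw [DO_bb, one_mul, inv_one, mul_one] at this
    exact this
  have hfb : ∀ j, f * ι X (bL j) * f⁻¹ ∈ D.H := by
    intro j
    have := D.univ_mem f (Or.inr (Or.inr rfl)) j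
    rw [DO_bb] at this
    exact this
  let K1 : Subgroup (Perm (Om X)) := D.H ⊓ D.H.comap (MulAut.conj f).toMonoidHom
  have hK : ∀ j, ι X (bL j) ∈ K1 := fun j => ⟨hb j, hfb j⟩
  have hQ : ι X qL ∈ K1 := by
    unfold qL cL
    simp only [map_mul, map_inv]
    exact mul_mem (mul_mem (mul_mem (hK 1) (inv_mem (hK 3))) (hK 2))
      (inv_mem (mul_mem (hK 1) (inv_mem (hK 3))))
  have hR : ι X ((bL 2) ^ k) ∈ K1 := by
    rw [map_zpow]; exact zpow_mem (hK 2) k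
  set R := ι X ((bL 2) ^ k) with hRd
  set Q := ι X qL with hQd
  have hX : R * Q * R⁻¹ ∈ K1 := mul_mem (mul_mem hR hQ) (inv_mem hR)
  have h1 : f * (R * Q * R⁻¹) * f⁻¹ * (R * Q * R⁻¹)⁻¹ ∈ D.H := mul_mem hX.2 (inv_mem hX.1)
  have h2 : R⁻¹ * (f * (R * Q * R⁻¹) * f⁻¹ * (R * Q * R⁻¹)⁻¹) * R ∈ D.H :=
    mul_mem (mul_mem (inv_mem hR.1) h1) hR.1
  have e1 : R⁻¹ * f * R = lab X (fun ℓ => ff gs (((bL 2) ^ k) ℓ)) := by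
    have := lab_conj (X := X) ((bL 2) ^ k)⁻¹ (ff gs)
    rw [map_inv, inv_inv, inv_inv] at this
    exact this
  have e2 : R⁻¹ * (f * (R * Q * R⁻¹) * f⁻¹ * (R * Q * R⁻¹)⁻¹) * R =
      (R⁻¹ * f * R) * (Q * (R⁻¹ * f * R)⁻¹ * Q⁻¹) := by group
  rw [e2, e1, ← map_inv, lab_conj, ← map_mul] at h2
  have e3 : Ψ X (gs k * (gs (k-1))⁻¹) = lab X ((fun ℓ => ff gs (((bL 2) ^ k) ℓ)) *
      fun ℓ => (fun ℓ => ff gs (((bL 2) ^ k) ℓ))⁻¹ (qL⁻¹ ℓ)) := by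
    rw [Ψ_eq]
    congr 1
    funext ℓ
    exact (ff_quot gs k ℓ).symm
  rw [e3]
  exact h2

lemma A0_3 : iL 3 ∈ A0 := ⟨q40, q4⟩

lemma Ψ_3 (a : G) (u : ℕ → X) : Ψ X a ⟨iL 3, u⟩ = ⟨iL 3, sact a u⟩ := by
  classical
  rw [Ψ_eq, lab_apply]
  simp only [if_pos A0_3]

lemma Ψ_inj [FaithfulSMul G X] : Function.Injective (Ψ (G := G) X) := by
  intro a b h
  apply sact_faithful (X := X)
  intro u
  have := congrArg (fun e : Perm (Om X) => (e ⟨iL 3, u⟩).z) h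
  simpa only [Ψ_3] using this

lemma Ψ_frat [FaithfulSMul G X] {a b : G} {h : Perm (Om X)} (hh : h ∈ KT G X)
    (e : h * Ψ X a = Ψ X b * h) : IsConj a b := by
  classical
  have triv : a = 1 → IsConj a b := by
    rintro rfl
    rw [map_one, mul_one] at e
    have : Ψ X b = Ψ X (1:G) := by rw [map_one]; exact (mul_eq_right.mp e.symm)
    rw [Ψ_inj this]
  obtain ⟨k, ℓ', p', g, ht⟩ := hh.1 (iL 3) []
  simp only [List.nil_append] at ht
  obtain ⟨b', hb', hbb⟩ : ∃ b', (b' = b ∨ b' = 1) ∧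
      ∀ z, Ψ X b ⟨ℓ', z⟩ = ⟨ℓ', sact b' z⟩ := by
    refine ⟨if ℓ' ∈ A0 then b else 1, by split_ifs <;> simp, fun z => rfl⟩
  have key : ∀ u, app p' (sact (g * a) u) = sact b' (app p' (sact g u)) := by
    intro u
    have h1 := congrArg (fun e : Perm (Om X) => e ⟨iL 3, app (List.replicate k ⊥) u⟩) e
    simp only [Perm.mul_apply] at h1
    rw [Ψ_3, sact_rep, ht, ht, hbb] at h1
    rw [sact_mul]
    exact congrArg Om.z h1
  rcases dich b' p' with hd | ⟨p'', hl, hd⟩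
  · have : g * a = b' * g := by
      apply sact_faithful (X := X)
      intro u
      have := key u
      rw [hd, ← sact_mul] at this
      exact app_inj rfl this
    rcases hb' with rfl | rfl
    · rw [isConj_iff]; exact ⟨g, by rw [this, mul_inv_cancel_right]⟩
    · apply triv; rw [one_mul] at this; exact mul_eq_left.mp this
  · apply triv
    have : g * a = g := by
      apply sact_faithful (X := X)
      intro u
      have := key u
      rw [hd] at this
      exact app_inj hl.symm this
    exact mul_eq_left.mp this

theorem main_act [Countable G] [FaithfulSMul G X] [Countable X] [DenselyOrdered X]
    [NoMaxOrder X] : ∃ (H : Type) (_ : Group H), Group.FG H ∧ IsSimpleGroup H ∧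
      (∃ l : LinearOrder H, ∀ a b c : H, l.le b c → l.le (a * b) (a * c)) ∧
      ∃ φ : G →* H, Function.Injective φ ∧ ∀ a b, IsConj a b ↔ IsConj (φ a) (φ b) := by
  obtain ⟨μ⟩ := exists_Mu X
  obtain ⟨en, hen⟩ := exists_surjective_nat G
  let gs : ℤ → G := fun k => if Even k then en (k / 2).toNat else 1
  have hgs : ∀ a : G, ∃ k, gs k = a ∧ gs (k - 1) = 1 := by
    intro a
    obtain ⟨n, rfl⟩ := hen a
    refine ⟨2 * n, ?_, ?_⟩
    · simp only [gs]
      rw [if_pos (by simp)]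
      congr 1
      omega
    · simp only [gs]
      rw [if_neg]
      rw [Int.not_even_iff_odd]
      exact ⟨n - 1, by ring⟩
  have hmem : ∀ a : G, Ψ X a ∈ (DO μ (ff gs) (ff_t gs)).H := by
    intro a
    obtain ⟨k, h1, h2⟩ := hgs a
    have := Ψ_mem (X := X) μ gs k
    rwa [h1, h2, inv_one, mul_one] at this
  refine ⟨(DO μ (ff gs) (ff_t gs)).H, inferInstance, Dat.H_fg _, DO_simple _ _ _, Dat.H_lo _,
    (Ψ X).codRestrict _ hmem, ?_, ?_⟩
  · intro a b h
    exact Ψ_inj (congrArg Subtype.val h)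
  · intro a b
    constructor
    · intro h
      exact ((Ψ X).codRestrict _ hmem).map_isConj h
    · intro h
      obtain ⟨c, hc⟩ := isConj_iff.mp h
      apply Ψ_frat (X := X) (h := c.1) (H_le_KT μ (ff gs) (ff_t gs) c.2)
      have := congrArg Subtype.val hc
      change c.1 * Ψ X a * c.1⁻¹ = Ψ X b at this
      rw [← this, inv_mul_cancel_right]

end emb

section fin
variable {G : Type} [Group G] [LinearOrder G]

/-- The action on the label set. -/
def mkAct (hl : ∀ a b c : G, b ≤ c → a * b ≤ a * c) : Act G (WithBot (G ×ₗ ℚ)) where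
  smul g x := WithBot.map (fun p => toLex (g * (ofLex p).1, (ofLex p).2)) x
  one_smul x := by
    change WithBot.map _ x = x
    induction x with
    | bot => rfl
    | coe p => simp
  mul_smul g h x := by
    change WithBot.map _ x = WithBot.map _ (WithBot.map _ x)
    induction x with
    | bot => rfl
    | coe p => simp [mul_assoc]
  mono g := by
    apply WithBot.strictMono_map_iff.mpr
    intro p p' h
    rw [Prod.Lex.lt_iff] at h
    rw [Prod.Lex.toLex_lt_toLex]
    rcases h with h | ⟨h, h'⟩
    · left
      exact lt_of_le_of_ne (hl _ _ _ h.le) (fun e => h.ne (mul_left_cancel e))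
    · right; exact ⟨by rw [h], h'⟩

theorem main_G [Countable G] (hl : ∀ a b c : G, b ≤ c → a * b ≤ a * c) :
    ∃ (H : Type) (_ : Group H), Group.FG H ∧ IsSimpleGroup H ∧
      (∃ l : LinearOrder H, ∀ a b c : H, l.le b c → l.le (a * b) (a * c)) ∧
      ∃ φ : G →* H, Function.Injective φ ∧ ∀ a b, IsConj a b ↔ IsConj (φ a) (φ b) := by
  letI := mkAct hl
  have : Countable (G ×ₗ ℚ) := inferInstanceAs (Countable (G × ℚ))
  have : Countable (WithBot (G ×ₗ ℚ)) := inferInstanceAs (Countable (Option (G ×ₗ ℚ)))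
  have : Nonempty (G ×ₗ ℚ) := ⟨toLex (1, 0)⟩
  have : FaithfulSMul G (WithBot (G ×ₗ ℚ)) := ⟨by
    intro g h e
    have := e ((toLex (1, 0) : G ×ₗ ℚ) : WithBot (G ×ₗ ℚ))
    change WithBot.map _ _ = WithBot.map _ _ at this
    simp only [WithBot.map_coe, WithBot.coe_inj] at this
    have := congrArg (fun p => (ofLex p).1) this
    simpa using this⟩
  exact main_act (X := WithBot (G ×ₗ ℚ))

end fin

end FE

theorem frattini_embedding_into_fg_leftOrderable_simple
    (G : Type) [Group G] [Countable G] (hG : IsLeftOrderable G) :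
    ∃ (H : Type) (_ : Group H), Group.FG H ∧ IsSimpleGroup H ∧ IsLeftOrderable H ∧
      ∃ φ : G →* H, IsFrattini φ := by
  obtain ⟨l, hl⟩ := hG
  exact @FE.main_G G _ l _ hl
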